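/- arXiv:1108.1312 — 2 statements merged into one kernel-verified Lean document; each statement's English description precedes it below -/
import Mathlib

section
/- Let N ≥ 3 be an integer, let a, b > −2 and p, q > 0. Assume that either pq ≤ 1, or pq > 1 and max{ (2(p+1)+a+bp)/(pq−1) , (2(q+1)+b+aq)/(pq−1) } ≥ N−2. Then there exists no pair (u, v) of positive supersolutions of the Hardy–Hénon system on ℝ^N, i.e., no pair of functions u, v : ℝ^N → ℝ that are continuous on ℝ^N, twice continuously differentiable on ℝ^N \ {0}, satisfy u(x) > 0 and v(x) > 0 for all x ∈ ℝ^N, and −Δu(x) ≥ |x|^a v(x)^p, −Δv(x) ≥ |x|^b u(x)^q for all x ∈ ℝ^N \ {0}. -/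
open MeasureTheory Metric Set Filter

/-- The Euclidean Laplacian of `u : ℝ^N → ℝ`, as the sum of the second derivatives
along the standard coordinate directions. -/
noncomputable def lap {N : ℕ} (u : EuclideanSpace ℝ (Fin N) → ℝ)
    (x : EuclideanSpace ℝ (Fin N)) : ℝ :=
  ∑ i : Fin N, iteratedFDeriv ℝ 2 u x ![EuclideanSpace.single i 1, EuclideanSpace.single i 1]

/-- `(u, v)` is a positive solution of the Hardy–Hénon system
`-Δu = |x|^a v^p`, `-Δv = |x|^b u^q` on the set `Ω`:
`u, v` are continuous on `Ω`, `C²` on `Ω \ {0}`, positive on `Ω`, and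
the equations hold on `Ω \ {0}`. -/
def IsHHSol {N : ℕ} (a b p q : ℝ) (Ω : Set (EuclideanSpace ℝ (Fin N)))
    (u v : EuclideanSpace ℝ (Fin N) → ℝ) : Prop :=
  ContinuousOn u Ω ∧ ContinuousOn v Ω ∧
  ContDiffOn ℝ 2 u (Ω \ {0}) ∧ ContDiffOn ℝ 2 v (Ω \ {0}) ∧
  (∀ x ∈ Ω, 0 < u x) ∧ (∀ x ∈ Ω, 0 < v x) ∧
  (∀ x ∈ Ω \ {0}, -lap u x = ‖x‖ ^ a * v x ^ p) ∧
  (∀ x ∈ Ω \ {0}, -lap v x = ‖x‖ ^ b * u x ^ q)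

open scoped Topology

/-- The second derivative is nonnegative at a local minimum. -/
lemma IsLocalMin.second_deriv_nonneg {w w' : ℝ → ℝ} {t d : ℝ} (hmin : IsLocalMin w t)
    (hw : ∀ᶠ s in 𝓝 t, HasDerivAt w (w' s) s) (hw' : HasDerivAt w' d t) : 0 ≤ d := by
  by_contra! hd
  have hderiv : deriv w =ᶠ[𝓝 t] w' := hw.mono fun s hs => hs.deriv
  have hdd : deriv (deriv w) t = d := by rw [hderiv.deriv_eq, hw'.deriv]
  have hmax : IsLocalMax w t :=
    isLocalMax_of_deriv_deriv_neg (by rwa [hdd]) hmin.deriv_eq_zero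
      hw.self_of_nhds.continuousAt
  have hconst : w =ᶠ[𝓝 t] fun _ => w t := by
    filter_upwards [hmin, hmax] with s h1 h2 using le_antisymm h2 h1
  have hzero : deriv w =ᶠ[𝓝 t] fun _ => 0 := by
    filter_upwards [hconst.eventuallyEq_nhds] with s hs
    rw [hs.deriv_eq, deriv_const]
  rw [hzero.deriv_eq, deriv_const] at hdd
  exact hd.ne hdd.symm

section Comparison

variable {N : ℕ} {u : EuclideanSpace ℝ (Fin N) → ℝ}

lemma norm_sq_add_smul_single (x : EuclideanSpace ℝ (Fin N)) (i : Fin N) (t : ℝ) :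
    ‖x + t • EuclideanSpace.single i (1 : ℝ)‖ ^ 2 = ‖x‖ ^ 2 + 2 * t * x i + t ^ 2 := by
  rw [norm_add_sq_real, inner_smul_right, EuclideanSpace.inner_single_right, norm_smul]
  simp
  ring

/-- At a local minimum of `u - G(‖·‖²)`, the Laplacian of `u` dominates that of `G(‖·‖²)`. -/
lemma radial_laplacian_le_lap {G G' : ℝ → ℝ} {d : ℝ} {x : EuclideanSpace ℝ (Fin N)}
    (hu : ContDiffAt ℝ 2 u x)
    (hmin : IsLocalMin (fun y => u y - G (‖y‖ ^ 2)) x)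
    (hG : ∀ᶠ s in 𝓝 (‖x‖ ^ 2), HasDerivAt G (G' s) s)
    (hG' : HasDerivAt G' d (‖x‖ ^ 2)) :
    4 * ‖x‖ ^ 2 * d + 2 * N * G' (‖x‖ ^ 2) ≤ lap u x := by
  have key : ∀ i : Fin N, 4 * x i ^ 2 * d + 2 * G' (‖x‖ ^ 2) ≤
      iteratedFDeriv ℝ 2 u x ![EuclideanSpace.single i 1, EuclideanSpace.single i 1] := by
    intro i
    set e : EuclideanSpace ℝ (Fin N) := EuclideanSpace.single i 1 with he
    have hline : ∀ t : ℝ, HasDerivAt (fun t : ℝ => x + t • e) e t := fun t => by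
      simpa using ((hasDerivAt_id t).smul_const e).const_add x
    have hcont : Tendsto (fun t : ℝ => x + t • e) (𝓝 0) (𝓝 x) := by
      simpa using (hline 0).continuousAt.tendsto
    have hsq : ∀ t : ℝ, HasDerivAt (fun t : ℝ => ‖x + t • e‖ ^ 2) (2 * x i + 2 * t) t := by
      intro t
      simp_rw [he, norm_sq_add_smul_single]
      have h := ((((hasDerivAt_id t).const_mul 2).mul_const (x i)).const_add (‖x‖ ^ 2)).add
        ((hasDerivAt_id t).pow 2)
      refine h.congr_deriv ?_
      simp
    have hsqc : Tendsto (fun t : ℝ => ‖x + t • e‖ ^ 2) (𝓝 0) (𝓝 (‖x‖ ^ 2)) := by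
      simpa using (hsq 0).continuousAt.tendsto
    have hudiff : ∀ᶠ y in 𝓝 x, HasFDerivAt u (fderiv ℝ u y) y := by
      filter_upwards [hu.eventually (by simp)] with y hy
      exact (hy.differentiableAt (by simp)).hasFDerivAt
    have hfd : HasFDerivAt (fderiv ℝ u) (fderiv ℝ (fderiv ℝ u) x) x :=
      ((hu.fderiv_right (m := 1) (by norm_num)).differentiableAt (by simp)).hasFDerivAt
    have hx0 : x + (0 : ℝ) • e = x := by simp
    have hmin' : IsLocalMin (fun t : ℝ => u (x + t • e) - G (‖x + t • e‖ ^ 2)) 0 := by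
      have := hcont.eventually hmin
      simpa [IsLocalMin, IsMinFilter] using this
    have h2 := hmin'.second_deriv_nonneg
      (w' := fun t => fderiv ℝ u (x + t • e) e - G' (‖x + t • e‖ ^ 2) * (2 * x i + 2 * t))
      (d := fderiv ℝ (fderiv ℝ u) x e e -
        (d * (2 * x i) * (2 * x i) + G' (‖x‖ ^ 2) * 2)) ?_ ?_
    · rw [iteratedFDeriv_two_apply]
      simp only [Matrix.cons_val_zero, Matrix.cons_val_one]
      linarith
    · filter_upwards [hcont.eventually hudiff, hsqc.eventually hG] with t h1 h2
      exact (h1.comp_hasDerivAt t (hline t)).sub (h2.comp t (hsq t))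
    · have h1 : HasDerivAt (fun t : ℝ => fderiv ℝ u (x + t • e) e)
          (fderiv ℝ (fderiv ℝ u) x e e) 0 := by
        have h := HasFDerivAt.comp_hasDerivAt (f := fun t : ℝ => x + t • e) 0
          (by simpa only [hx0] using hfd) (hline 0)
        simpa using h.clm_apply (hasDerivAt_const (0 : ℝ) e)
      have h3 : HasDerivAt (fun t : ℝ => G' (‖x + t • e‖ ^ 2)) (d * (2 * x i)) 0 := by
        have h := HasDerivAt.comp (h := fun t : ℝ => ‖x + t • e‖ ^ 2) 0
          (by simpa only [hx0] using hG') (hsq 0)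
        exact h.congr_deriv (by simp)
      have h4 : HasDerivAt (fun t : ℝ => 2 * x i + 2 * t) 2 0 := by
        simpa using ((hasDerivAt_id (0 : ℝ)).const_mul 2).const_add (2 * x i)
      refine (h1.sub (h3.mul h4)).congr_deriv ?_
      simp
  calc 4 * ‖x‖ ^ 2 * d + 2 * N * G' (‖x‖ ^ 2)
      = ∑ i : Fin N, (4 * x i ^ 2 * d + 2 * G' (‖x‖ ^ 2)) := by
        rw [EuclideanSpace.real_norm_sq_eq, Finset.sum_add_distrib, ← Finset.sum_mul,
          ← Finset.mul_sum]
        simp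
        ring
    _ ≤ lap u x := Finset.sum_le_sum fun i _ => key i

/-- Comparison of a strict supersolution with a radial function on an annulus. -/
lemma radial_le_of_annulus {G G' G'' : ℝ → ℝ} {r R : ℝ} (hr : 0 < r)
    (hu : ContDiffOn ℝ 2 u {0}ᶜ)
    (hG : ∀ s, 0 < s → HasDerivAt G (G' s) s) (hG' : ∀ s, 0 < s → HasDerivAt G' (G'' s) s)
    (hlap : ∀ x : EuclideanSpace ℝ (Fin N), r < ‖x‖ → ‖x‖ < R →
      -(4 * ‖x‖ ^ 2 * G'' (‖x‖ ^ 2) + 2 * N * G' (‖x‖ ^ 2)) < -lap u x)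
    (hin : ∀ x, ‖x‖ = r → G (r ^ 2) ≤ u x) (hout : ∀ x, ‖x‖ = R → G (R ^ 2) ≤ u x)
    {x : EuclideanSpace ℝ (Fin N)} (hrx : r ≤ ‖x‖) (hxR : ‖x‖ ≤ R) :
    G (‖x‖ ^ 2) ≤ u x := by
  set A : Set (EuclideanSpace ℝ (Fin N)) := closedBall 0 R ∩ {y | r ≤ ‖y‖} with hA
  have hAc : IsCompact A :=
    (isCompact_closedBall _ _).inter_right (isClosed_le continuous_const continuous_norm)
  have hpos : ∀ y ∈ A, 0 < ‖y‖ := fun y hy => hr.trans_le hy.2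
  have hcont : ContinuousOn (fun y => u y - G (‖y‖ ^ 2)) A := by
    intro y hy
    have hy0 : y ≠ 0 := norm_pos_iff.1 (hpos y hy)
    have h1 : ContinuousAt u y :=
      hu.continuousOn.continuousAt (isOpen_compl_singleton.mem_nhds hy0)
    have h2 : ContinuousAt (fun y : EuclideanSpace ℝ (Fin N) => G (‖y‖ ^ 2)) y :=
      ContinuousAt.comp (f := fun y : EuclideanSpace ℝ (Fin N) => ‖y‖ ^ 2)
        (hG _ (pow_pos (hpos y hy) 2)).continuousAt (by fun_prop)
    exact (h1.sub h2).continuousWithinAt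
  have hxA : x ∈ A := ⟨by simpa using hxR, hrx⟩
  obtain ⟨z, hz, hzmin⟩ := hAc.exists_isMinOn ⟨x, hxA⟩ hcont
  suffices h : G (‖z‖ ^ 2) ≤ u z by
    have : u z - G (‖z‖ ^ 2) ≤ u x - G (‖x‖ ^ 2) := hzmin hxA
    linarith
  have hzR : ‖z‖ ≤ R := by simpa using hz.1
  have hrz : r ≤ ‖z‖ := hz.2
  rcases hrz.eq_or_lt with h | hrz
  · rw [← h]; exact hin z h.symm
  rcases hzR.eq_or_lt with h | hzR
  · rw [h]; exact hout z h
  exfalso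
  have hz0 : z ≠ 0 := norm_pos_iff.1 (hpos z hz)
  have hnhds : A ∈ 𝓝 z := by
    filter_upwards [(isOpen_lt continuous_norm continuous_const).mem_nhds hzR,
      (isOpen_lt continuous_const continuous_norm).mem_nhds hrz] with y h1 h2
    have h1 : ‖y‖ < R := h1
    have h2 : r < ‖y‖ := h2
    exact ⟨by simpa using h1.le, h2.le⟩
  have hz2 : 0 < ‖z‖ ^ 2 := pow_pos (hpos z hz) 2
  have := radial_laplacian_le_lap (hu.contDiffAt (isOpen_compl_singleton.mem_nhds hz0))
    (hzmin.isLocalMin hnhds) ((eventually_gt_nhds hz2).mono hG) (hG' _ hz2)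
  linarith [hlap z hrz hzR]

/-- Comparison of a positive strict supersolution with a radial function vanishing at infinity. -/
lemma radial_le_of_exterior {G G' G'' : ℝ → ℝ} {r : ℝ} (hr : 0 < r)
    (hu : ContDiffOn ℝ 2 u {0}ᶜ) (hupos : ∀ x, 0 < u x)
    (hG : ∀ s, 0 < s → HasDerivAt G (G' s) s) (hG' : ∀ s, 0 < s → HasDerivAt G' (G'' s) s)
    (hlap : ∀ x : EuclideanSpace ℝ (Fin N), r < ‖x‖ →
      -(4 * ‖x‖ ^ 2 * G'' (‖x‖ ^ 2) + 2 * N * G' (‖x‖ ^ 2)) < -lap u x)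
    (hin : ∀ x, ‖x‖ = r → G (r ^ 2) ≤ u x) (hlim : Tendsto G atTop (𝓝 0))
    {x : EuclideanSpace ℝ (Fin N)} (hrx : r ≤ ‖x‖) :
    G (‖x‖ ^ 2) ≤ u x := by
  refine le_of_forall_pos_le_add fun ε hε => ?_
  have hsq : Tendsto (fun R : ℝ => R ^ 2) atTop atTop := tendsto_pow_atTop two_ne_zero
  obtain ⟨R, hR, hxR⟩ := (((hlim.comp hsq).eventually (gt_mem_nhds hε)).and
    (eventually_ge_atTop ‖x‖)).exists
  have hR : G (R ^ 2) < ε := hR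
  have := radial_le_of_annulus (G := fun s => G s - ε) hr hu
    (fun s hs => (hG s hs).sub_const ε) hG' (fun y h _ => hlap y h)
    (fun y hy => by linarith [hin y hy]) (fun y _ => by linarith [hupos y]) hrx hxR
  linarith


lemma hasDerivAt_const_mul_rpow (A e : ℝ) {s : ℝ} (hs : 0 < s) :
    HasDerivAt (fun s : ℝ => A * s ^ e) (A * e * s ^ (e - 1)) s :=
  ((Real.hasDerivAt_rpow_const (Or.inl hs.ne')).const_mul A).congr_deriv (by ring)

lemma sq_rpow_half {ρ : ℝ} (hρ : 0 < ρ) (e : ℝ) : (ρ ^ 2) ^ (e / 2) = ρ ^ e := by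
  rw [← Real.rpow_natCast, ← Real.rpow_mul hρ.le]
  congr 1
  push_cast
  ring

lemma fundamental_solution_radial_laplacian (A : ℝ) {s : ℝ} (hs : 0 < s) :
    4 * s * (A * ((2 - N : ℝ) / 2) * ((2 - N : ℝ) / 2 - 1) * s ^ ((2 - N : ℝ) / 2 - 1 - 1)) +
      2 * N * (A * ((2 - N : ℝ) / 2) * s ^ ((2 - N : ℝ) / 2 - 1)) = 0 := by
  rw [Real.rpow_sub_one hs.ne' ((2 - N : ℝ) / 2 - 1)]
  field_simp
  ring

/-- The minimum of `u` over the sphere of radius `r` centred at the origin. -/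
noncomputable def sphereMin (u : EuclideanSpace ℝ (Fin N) → ℝ) (r : ℝ) : ℝ :=
  sInf (u '' sphere 0 r)

lemma sphereMin_le (hu : Continuous u) {r : ℝ} {x : EuclideanSpace ℝ (Fin N)} (hx : ‖x‖ = r) :
    sphereMin u r ≤ u x :=
  csInf_le ((isCompact_sphere _ _).image hu).bddBelow ⟨x, by simpa using hx, rfl⟩

lemma exists_eq_sphereMin (hN : 3 ≤ N) (hu : Continuous u) {r : ℝ} (hr : 0 ≤ r) :
    ∃ x, ‖x‖ = r ∧ u x = sphereMin u r := by
  have : Nonempty (Fin N) := ⟨⟨0, by omega⟩⟩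
  have hne : (sphere (0 : EuclideanSpace ℝ (Fin N)) r).Nonempty := NormedSpace.sphere_nonempty.2 hr
  obtain ⟨x, hx, h⟩ := ((isCompact_sphere (0 : EuclideanSpace ℝ (Fin N)) r).image hu).sInf_mem
    (hne.image u)
  exact ⟨x, by simpa using hx, h⟩

lemma sphereMin_pos (hN : 3 ≤ N) (hu : Continuous u) (hupos : ∀ x, 0 < u x) {r : ℝ}
    (hr : 0 ≤ r) : 0 < sphereMin u r := by
  obtain ⟨x, -, hx⟩ := exists_eq_sphereMin hN hu hr
  exact hx ▸ hupos x

lemma two_sub_natCast_neg (hN : 3 ≤ N) : (2 - N : ℝ) < 0 := by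
  have : (3 : ℝ) ≤ N := by exact_mod_cast hN
  linarith

/-- A positive superharmonic function decays at most like the fundamental solution. -/
lemma sphereMin_mul_rpow_le (hN : 3 ≤ N) (hc : Continuous u) (hu : ContDiffOn ℝ 2 u {0}ᶜ)
    (hupos : ∀ x, 0 < u x) (hlap : ∀ x, x ≠ 0 → 0 < -lap u x) {r ρ : ℝ} (hr : 0 < r)
    (hrρ : r ≤ ρ) : sphereMin u r * (ρ / r) ^ (2 - N : ℝ) ≤ sphereMin u ρ := by
  obtain ⟨x, hx, hxm⟩ := exists_eq_sphereMin hN hc (hr.le.trans hrρ)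
  set A : ℝ := sphereMin u r / r ^ (2 - N : ℝ) with hA
  have hρ : 0 < ρ := hr.trans_le hrρ
  have h := radial_le_of_exterior (G := fun s => A * s ^ ((2 - N : ℝ) / 2)) hr hu hupos
    (fun s hs => hasDerivAt_const_mul_rpow _ _ hs)
    (fun s hs => hasDerivAt_const_mul_rpow _ _ hs) (fun y hy => ?_) (fun y hy => ?_) ?_
    (x := x) (hx ▸ hrρ)
  · rw [← hxm]
    refine le_trans (le_of_eq ?_) h
    rw [hx, sq_rpow_half hρ, hA, Real.div_rpow hρ.le hr.le]
    ring
  · have hy0 := hr.trans hy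
    rw [fundamental_solution_radial_laplacian A (pow_pos hy0 2), neg_zero]
    exact hlap y (norm_pos_iff.1 hy0)
  · have : r ^ (2 - N : ℝ) ≠ 0 := (Real.rpow_pos_of_pos hr _).ne'
    rw [sq_rpow_half hr, hA, div_mul_cancel₀ _ this]
    exact sphereMin_le hc hy
  · have := (tendsto_rpow_neg_atTop (y := -((2 - N : ℝ) / 2))
      (by linarith [two_sub_natCast_neg hN])).const_mul A
    simpa using this

lemma sphereMin_mul_le (hN : 3 ≤ N) (hc : Continuous u) (hu : ContDiffOn ℝ 2 u {0}ᶜ)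
    (hupos : ∀ x, 0 < u x) (hlap : ∀ x, x ≠ 0 → 0 < -lap u x) {r R : ℝ} (hr : 0 < r)
    (hrR : 2 * r ≤ R) : sphereMin u R * (1 - 2 ^ (2 - N : ℝ)) ≤ sphereMin u (2 * r) := by
  obtain ⟨x, hx, hxm⟩ := exists_eq_sphereMin hN hc (r := 2 * r) (by positivity)
  have hR : 0 < R := by linarith
  have hm : 0 < sphereMin u R := sphereMin_pos hN hc hupos hR.le
  have hrp : 0 < r ^ (2 - N : ℝ) := Real.rpow_pos_of_pos hr _
  set A : ℝ := -(sphereMin u R / r ^ (2 - N : ℝ)) with hA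
  have hAr : A * r ^ (2 - N : ℝ) = -sphereMin u R := by rw [hA]; field_simp
  have h := radial_le_of_annulus
    (G := fun s => A * s ^ ((2 - N : ℝ) / 2) + sphereMin u R) (R := R) hr hu
    (fun s hs => (hasDerivAt_const_mul_rpow _ _ hs).add_const _)
    (fun s hs => hasDerivAt_const_mul_rpow _ _ hs) (fun y hy _ => ?_) (fun y hy => ?_)
    (fun y hy => ?_) (x := x) (by linarith) (by linarith)
  · rw [← hxm]
    refine le_trans (le_of_eq ?_) h
    rw [hx, sq_rpow_half (by positivity), Real.mul_rpow zero_le_two hr.le]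
    linear_combination (-(2 : ℝ) ^ (2 - N : ℝ)) * hAr
  · have hy0 := hr.trans hy
    rw [fundamental_solution_radial_laplacian A (pow_pos hy0 2), neg_zero]
    exact hlap y (norm_pos_iff.1 hy0)
  · rw [sq_rpow_half hr, hAr]
    linarith [hupos y]
  · rw [sq_rpow_half hR]
    have hA0 : A ≤ 0 := by rw [hA]; simp only [Left.neg_nonpos_iff]; positivity
    have : A * R ^ (2 - N : ℝ) ≤ 0 :=
      mul_nonpos_of_nonpos_of_nonneg hA0 (Real.rpow_nonneg hR.le _)
    linarith [sphereMin_le hc hy]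

lemma one_sub_two_rpow_pos (hN : 3 ≤ N) : 0 < 1 - (2 : ℝ) ^ (2 - N : ℝ) := by
  have := Real.rpow_lt_one_of_one_lt_of_neg one_lt_two (two_sub_natCast_neg hN)
  linarith

/-- A lower bound on `-Δu` over an annulus bounds `u` from below in its middle. -/
lemma le_sphereMin_of_le_neg_lap (hN : 3 ≤ N) (hc : Continuous u) (hu : ContDiffOn ℝ 2 u {0}ᶜ)
    (hupos : ∀ x, 0 < u x) {R F : ℝ} (hR : 0 < R) (hF : 0 < F)
    (hlap : ∀ x, R < ‖x‖ → ‖x‖ < 4 * R → F ≤ -lap u x) :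
    36 / (16 * (8 + 4 * N)) * R ^ 2 * F ≤ sphereMin u (2 * R) := by
  obtain ⟨x, hx, hxm⟩ := exists_eq_sphereMin hN hc (r := 2 * R) (by positivity)
  set δ : ℝ := F / (16 * (8 + 4 * N) * R ^ 2) with hδ
  have hδ0 : 0 < δ := by positivity
  have hδF : δ * (16 * (8 + 4 * N) * R ^ 2) = F := by rw [hδ]; field_simp
  have hG : ∀ s : ℝ, HasDerivAt (fun s => δ * ((s - R ^ 2) * (16 * R ^ 2 - s)))
      (δ * (17 * R ^ 2 - 2 * s)) s := fun s =>
    ((((hasDerivAt_id s).sub_const _).mul ((hasDerivAt_id s).const_sub _)).const_mul δ).congr_deriv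
      (by simp only [id]; ring)
  have hG' : ∀ s : ℝ, HasDerivAt (fun s => δ * (17 * R ^ 2 - 2 * s)) (δ * -2) s := fun s =>
    ((((hasDerivAt_id s).const_mul 2).const_sub _).const_mul δ).congr_deriv (by simp)
  have h := radial_le_of_annulus (R := 4 * R) hR hu (fun s _ => hG s) (fun s _ => hG' s)
    (fun y hy hy' => ?_) (fun y hy => ?_) (fun y hy => ?_) (x := x) (by linarith) (by linarith)
  · rw [← hxm]
    refine le_trans (le_of_eq ?_) h
    rw [hx, ← hδF]
    field_simp
    ring
  · refine lt_of_lt_of_le ?_ (hlap y hy hy')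
    have hN0 : (3 : ℝ) ≤ N := by exact_mod_cast hN
    have hy2 : ‖y‖ ^ 2 < 16 * R ^ 2 := by nlinarith [norm_nonneg y]
    rw [← hδF]
    have h1 : (8 + 4 * N) * ‖y‖ ^ 2 < (8 + 4 * N) * (16 * R ^ 2) := by gcongr
    have h2 : (0 : ℝ) ≤ 34 * N * R ^ 2 := by positivity
    have := mul_lt_mul_of_pos_left (show (8 + 4 * N) * ‖y‖ ^ 2 - 34 * N * R ^ 2 <
      16 * (8 + 4 * N) * R ^ 2 by linarith) hδ0
    linarith
  · simpa using (hupos y).le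
  · have : δ * (((4 * R) ^ 2 - R ^ 2) * (16 * R ^ 2 - (4 * R) ^ 2)) = 0 := by ring
    rw [this]
    exact (hupos y).le

/-- A lower bound `-Δu ≥ c |x|^(-N)` forces a logarithmic gain over the fundamental solution. -/
lemma exists_log_le_sphereMin (hN : 3 ≤ N) (hc : Continuous u) (hu : ContDiffOn ℝ 2 u {0}ᶜ)
    (hupos : ∀ x, 0 < u x) {c : ℝ} (hc0 : 0 < c)
    (hlap : ∀ x, 1 ≤ ‖x‖ → c * ‖x‖ ^ (-N : ℝ) ≤ -lap u x) :
    ∃ ε > 0, ∀ r, 1 ≤ r → ε * (r ^ (2 - N : ℝ) * Real.log r) ≤ sphereMin u r := by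
  have hN0 := two_sub_natCast_neg hN
  set e : ℝ := (2 - N : ℝ) / 2 with he
  have hNe : (N : ℝ) = 2 - 2 * e := by rw [he]; ring
  have he0 : e < 0 := by rw [he]; linarith
  set δ : ℝ := c / (-8 * e) with hδ
  have hδ0 : 0 < δ := div_pos hc0 (by linarith)
  have hδc : δ * (-8 * e) = c := by
    have := he0.ne
    rw [hδ]; field_simp
  refine ⟨2 * δ, by positivity, fun r hr => ?_⟩
  have hr0 : 0 < r := by linarith
  obtain ⟨x, hx, hxm⟩ := exists_eq_sphereMin hN hc hr0.le
  have hG : ∀ s : ℝ, 0 < s → HasDerivAt (fun s => δ * s ^ e * Real.log s)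
      (δ * e * s ^ (e - 1) * Real.log s + δ * s ^ (e - 1)) s := fun s hs =>
    ((hasDerivAt_const_mul_rpow δ e hs).mul (Real.hasDerivAt_log hs.ne')).congr_deriv (by
      rw [Real.rpow_sub_one hs.ne']; field_simp)
  have hG' : ∀ s : ℝ, 0 < s → HasDerivAt
      (fun s => δ * e * s ^ (e - 1) * Real.log s + δ * s ^ (e - 1))
      (δ * e * (e - 1) * s ^ (e - 1 - 1) * Real.log s + δ * e * s ^ (e - 1 - 1) +
        δ * (e - 1) * s ^ (e - 1 - 1)) s := fun s hs =>
    (((hasDerivAt_const_mul_rpow (δ * e) (e - 1) hs).mul (Real.hasDerivAt_log hs.ne')).add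
      (hasDerivAt_const_mul_rpow δ (e - 1) hs)).congr_deriv (by
      rw [Real.rpow_sub_one hs.ne' (e - 1)]; field_simp)
  have h := radial_le_of_exterior one_pos hu hupos hG hG' (fun y hy => ?_) (fun y hy => ?_) ?_
    (x := x) (hx ▸ hr)
  · rw [← hxm]
    refine le_trans (le_of_eq ?_) h
    rw [hx, he, sq_rpow_half hr0, Real.log_pow]
    push_cast
    ring
  · have hy0 : 0 < ‖y‖ := one_pos.trans hy
    refine lt_of_lt_of_le ?_ (hlap y hy.le)
    have hpow : ‖y‖ ^ (-N : ℝ) = (‖y‖ ^ 2) ^ (e - 1) := by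
      rw [show e - 1 = (-N : ℝ) / 2 by rw [hNe]; ring, sq_rpow_half hy0]
    have hs : 0 < ‖y‖ ^ 2 := pow_pos hy0 2
    rw [hpow]
    set s := ‖y‖ ^ 2
    have hP : 0 < s ^ (e - 1) := Real.rpow_pos_of_pos hs _
    have hlhs : -(4 * s * (δ * e * (e - 1) * s ^ (e - 1 - 1) * Real.log s +
        δ * e * s ^ (e - 1 - 1) + δ * (e - 1) * s ^ (e - 1 - 1)) +
        2 * N * (δ * e * s ^ (e - 1) * Real.log s + δ * s ^ (e - 1))) =
        c / 2 * s ^ (e - 1) := by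
      rw [Real.rpow_sub_one hs.ne' (e - 1), hNe, ← hδc]
      field_simp
      ring
    rw [hlhs]
    exact mul_lt_mul_of_pos_right (by linarith) hP
  · simpa using (hupos y).le
  · have := ((isLittleO_log_rpow_atTop (neg_pos.2 he0)).tendsto_div_nhds_zero).const_mul δ
    rw [mul_zero] at this
    refine this.congr' ?_
    filter_upwards [eventually_gt_atTop 0] with s hs
    rw [Real.rpow_neg hs.le]
    field_simp

lemma min_rpow_le_rpow (a : ℝ) {t : ℝ} (h₁ : 1 / 2 ≤ t) (h₂ : t ≤ 2) :
    min ((1 / 2) ^ a) (2 ^ a) ≤ t ^ a := by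
  rcases le_total 0 a with h | h
  · exact (min_le_left _ _).trans (Real.rpow_le_rpow (by norm_num) h₁ h)
  · exact (min_le_right _ _).trans (Real.rpow_le_rpow_of_nonpos (by linarith) h₂ h)

/-- The inequality `-Δu ≥ |x|^a v^p` passes to the spherical minima. -/
lemma exists_coupling {v : EuclideanSpace ℝ (Fin N) → ℝ} {a p : ℝ} (hN : 3 ≤ N) (hp : 0 < p)
    (huc : Continuous u) (hu : ContDiffOn ℝ 2 u {0}ᶜ) (hupos : ∀ x, 0 < u x)
    (hvc : Continuous v) (hv : ContDiffOn ℝ 2 v {0}ᶜ) (hvpos : ∀ x, 0 < v x)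
    (hlapv : ∀ x, x ≠ 0 → 0 < -lap v x)
    (hlapu : ∀ x, x ≠ 0 → ‖x‖ ^ a * v x ^ p ≤ -lap u x) :
    ∃ c > 0, ∀ r, 0 < r → c * (r ^ (2 + a) * sphereMin v r ^ p) ≤ sphereMin u r := by
  set κ : ℝ := 2 ^ (2 - N : ℝ) * (1 - 2 ^ (2 - N : ℝ)) with hκ
  have hκ0 : 0 < κ := mul_pos (by positivity) (one_sub_two_rpow_pos hN)
  set l : ℝ := min ((1 / 2) ^ a) (2 ^ a) with hl
  have hl0 : 0 < l := lt_min (by positivity) (by positivity)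
  refine ⟨36 / (16 * (8 + 4 * N)) / 4 * l * κ ^ p, by positivity, fun r hr => ?_⟩
  have hm : 0 < sphereMin v r := sphereMin_pos hN hvc hvpos hr.le
  have h := le_sphereMin_of_le_neg_lap hN huc hu hupos (R := r / 2)
    (F := (l * r ^ a) * (κ * sphereMin v r) ^ p) (by positivity) (by positivity)
    fun x hx hx' => ?_
  · rw [mul_div_cancel₀ r two_ne_zero, Real.mul_rpow hκ0.le hm.le] at h
    refine le_trans (le_of_eq ?_) h
    rw [Real.rpow_add hr, Real.rpow_two]
    ring
  · have hx0 : 0 < ‖x‖ := by linarith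
    refine le_trans ?_ (hlapu x (norm_pos_iff.1 hx0))
    have h1 : l * r ^ a ≤ ‖x‖ ^ a := by
      have := min_rpow_le_rpow a (t := ‖x‖ / r) (by rw [le_div_iff₀ hr]; linarith)
        (by rw [div_le_iff₀ hr]; linarith)
      rwa [Real.div_rpow hx0.le hr.le, le_div_iff₀ (by positivity)] at this
    have h2 : κ * sphereMin v r ≤ v x := by
      have h3 := sphereMin_mul_rpow_le hN hvc hv hvpos hlapv hr (ρ := 2 * r) (by linarith)
      have h4 := sphereMin_mul_le hN hvc hv hvpos hlapv (r := ‖x‖ / 2) (R := 2 * r)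
        (by positivity) (by linarith)
      rw [mul_div_cancel₀ _ two_ne_zero] at h4
      rw [mul_div_cancel_right₀ _ hr.ne'] at h3
      calc κ * sphereMin v r
          = sphereMin v r * 2 ^ (2 - N : ℝ) * (1 - 2 ^ (2 - N : ℝ)) := by rw [hκ]; ring
        _ ≤ sphereMin v (2 * r) * (1 - 2 ^ (2 - N : ℝ)) :=
          mul_le_mul_of_nonneg_right h3 (one_sub_two_rpow_pos hN).le
        _ ≤ sphereMin v ‖x‖ := h4
        _ ≤ v x := sphereMin_le hvc rfl
    exact mul_le_mul h1 (Real.rpow_le_rpow (by positivity) h2 hp.le) (by positivity)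
      (by positivity)

/-- Nonexistence when the scaling exponent of the first component is not below `N - 2`. -/
lemma false_of_positive_supersolution {v : EuclideanSpace ℝ (Fin N) → ℝ} {a b p q : ℝ}
    (hN : 3 ≤ N) (ha : -2 < a) (hb : -2 < b) (hp : 0 < p) (hq : 0 < q)
    (hcond : p * q ≤ 1 ∨
      1 < p * q ∧ (N : ℝ) - 2 ≤ (2 * (p + 1) + a + b * p) / (p * q - 1))
    (huc : Continuous u) (hvc : Continuous v)
    (hu : ContDiffOn ℝ 2 u {0}ᶜ) (hv : ContDiffOn ℝ 2 v {0}ᶜ)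
    (hupos : ∀ x, 0 < u x) (hvpos : ∀ x, 0 < v x)
    (hlapu : ∀ x, x ≠ 0 → ‖x‖ ^ a * v x ^ p ≤ -lap u x)
    (hlapv : ∀ x, x ≠ 0 → ‖x‖ ^ b * u x ^ q ≤ -lap v x) : False := by
  have hu' : ∀ x, x ≠ 0 → 0 < -lap u x := fun x hx =>
    (mul_pos (Real.rpow_pos_of_pos (norm_pos_iff.2 hx) _)
      (Real.rpow_pos_of_pos (hvpos x) _)).trans_le (hlapu x hx)
  have hv' : ∀ x, x ≠ 0 → 0 < -lap v x := fun x hx =>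
    (mul_pos (Real.rpow_pos_of_pos (norm_pos_iff.2 hx) _)
      (Real.rpow_pos_of_pos (hupos x) _)).trans_le (hlapv x hx)
  obtain ⟨c₁, hc₁, h₁⟩ := exists_coupling hN hp huc hu hupos hvc hv hvpos hv' hlapu
  obtain ⟨c₂, hc₂, h₂⟩ := exists_coupling hN hq hvc hv hvpos huc hu hupos hu' hlapv
  have hm : ∀ r, 0 < r → 0 < sphereMin u r := fun r hr => sphereMin_pos hN huc hupos hr.le
  set γ : ℝ := 2 + a + (2 + b) * p with hγ
  have hγ0 : 0 < γ := add_pos (by linarith) (mul_pos (by linarith) hp)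
  have key : ∀ r, 0 < r → c₁ * c₂ ^ p * r ^ γ * sphereMin u r ^ (p * q - 1) ≤ 1 := by
    intro r hr
    have hmr := hm r hr
    have h3 : c₁ * (r ^ (2 + a) * (c₂ * (r ^ (2 + b) * sphereMin u r ^ q)) ^ p) ≤
        sphereMin u r := by
      refine le_trans ?_ (h₁ r hr)
      gcongr
      exact h₂ r hr
    rw [Real.mul_rpow hc₂.le (by positivity), Real.mul_rpow (by positivity) (by positivity),
      ← Real.rpow_mul hr.le, ← Real.rpow_mul hmr.le] at h3
    rw [Real.rpow_sub_one hmr.ne', hγ, Real.rpow_add hr, mul_comm p q, ← mul_div_assoc,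
      div_le_one hmr]
    refine le_trans (le_of_eq ?_) h3
    ring
  rcases hcond with hpq | ⟨hpq, hα⟩
  · set M : ℝ := sphereMin u 2 / (1 - 2 ^ (2 - N : ℝ)) with hM
    have hM0 : 0 < M := div_pos (hm 2 two_pos) (one_sub_two_rpow_pos hN)
    set d : ℝ := c₁ * c₂ ^ p * M ^ (p * q - 1) with hd
    have hd0 : 0 < d := by positivity
    obtain ⟨r, hr, hr2⟩ := (((tendsto_rpow_atTop hγ0).eventually_gt_atTop (1 / d)).and
      (eventually_ge_atTop 2)).exists
    have hr0 : 0 < r := by linarith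
    rw [div_lt_iff₀ hd0] at hr
    have hle : sphereMin u r ≤ M := by
      rw [hM, le_div_iff₀ (one_sub_two_rpow_pos hN)]
      have := sphereMin_mul_le hN huc hu hupos hu' one_pos (R := r) (by linarith)
      rwa [mul_one] at this
    have hpow : M ^ (p * q - 1) ≤ sphereMin u r ^ (p * q - 1) :=
      Real.rpow_le_rpow_of_nonpos (hm r hr0) hle (by linarith)
    have : c₁ * c₂ ^ p * r ^ γ * M ^ (p * q - 1) ≤ 1 := by
      refine le_trans ?_ (key r hr0)
      gcongr
    have : r ^ γ * d ≤ 1 := by rw [hd]; linarith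
    linarith
  · have hκ : 0 < p * q - 1 := by linarith
    have hαγ : ((N : ℝ) - 2) * (p * q - 1) ≤ γ := by
      rw [le_div_iff₀ hκ] at hα
      linarith
    have hm1 := hm 1 one_pos
    have hlog : ∀ x : EuclideanSpace ℝ (Fin N), 1 ≤ ‖x‖ →
        (c₂ * sphereMin u 1 ^ q) ^ p * ‖x‖ ^ (-N : ℝ) ≤ -lap u x := by
      intro x hx
      have hx0 : 0 < ‖x‖ := by linarith
      refine le_trans ?_ (hlapu x (norm_pos_iff.1 hx0))
      have h3 : sphereMin u 1 * ‖x‖ ^ (2 - N : ℝ) ≤ sphereMin u ‖x‖ := by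
        simpa using sphereMin_mul_rpow_le hN huc hu hupos hu' one_pos hx
      have h4 : c₂ * (‖x‖ ^ (2 + b) * (sphereMin u 1 * ‖x‖ ^ (2 - N : ℝ)) ^ q) ≤ v x := by
        refine le_trans ?_ ((h₂ _ hx0).trans (sphereMin_le hvc rfl))
        gcongr
      have h5 : ‖x‖ ^ a * (c₂ * (‖x‖ ^ (2 + b) *
          (sphereMin u 1 * ‖x‖ ^ (2 - N : ℝ)) ^ q)) ^ p ≤ ‖x‖ ^ a * v x ^ p := by
        gcongr
      refine le_trans ?_ h5
      have h6 : c₂ * (‖x‖ ^ (2 + b) * (sphereMin u 1 * ‖x‖ ^ (2 - N : ℝ)) ^ q) =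
          (c₂ * sphereMin u 1 ^ q) * ‖x‖ ^ (2 + b + (2 - N) * q) := by
        rw [Real.mul_rpow hm1.le (by positivity), ← Real.rpow_mul hx0.le,
          Real.rpow_add hx0 (2 + b)]
        ring
      rw [h6, Real.mul_rpow (x := c₂ * sphereMin u 1 ^ q) (by positivity) (by positivity),
        ← Real.rpow_mul hx0.le,
        mul_left_comm, ← Real.rpow_add hx0]
      gcongr
      linarith
    obtain ⟨ε, hε, hεm⟩ := exists_log_le_sphereMin hN huc hu hupos (by positivity) hlog
    have hC : 0 < c₁ * c₂ ^ p := by positivity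
    obtain ⟨r, hr, hr1⟩ := (((((tendsto_rpow_atTop hκ).comp
      (Real.tendsto_log_atTop.const_mul_atTop hε))).eventually_gt_atTop (1 / (c₁ * c₂ ^ p))).and
      (eventually_ge_atTop 1)).exists
    rw [Function.comp_apply, div_lt_iff₀ hC] at hr
    have hr0 : 0 < r := by linarith
    have hlr : 0 ≤ Real.log r := Real.log_nonneg hr1
    have h7 : c₁ * c₂ ^ p * r ^ γ * (ε * (r ^ (2 - N : ℝ) * Real.log r)) ^ (p * q - 1) ≤ 1 := by
      refine le_trans ?_ (key r hr0)
      gcongr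
      exact hεm r hr1
    have h8 : ε * (r ^ (2 - N : ℝ) * Real.log r) = r ^ (2 - N : ℝ) * (ε * Real.log r) := by ring
    rw [h8, Real.mul_rpow (by positivity) (by positivity), ← Real.rpow_mul hr0.le, mul_assoc,
      ← mul_assoc (r ^ γ), ← Real.rpow_add hr0] at h7
    have h9 : 1 ≤ r ^ (γ + (2 - N : ℝ) * (p * q - 1)) :=
      Real.one_le_rpow hr1 (by linarith)
    have h10 : c₁ * c₂ ^ p * (1 * (ε * Real.log r) ^ (p * q - 1)) ≤ 1 := by
      refine le_trans ?_ h7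
      gcongr
    linarith

end Comparison

/-- Theorem A: nonexistence of positive supersolutions of the Hardy–Hénon system on `ℝ^N`. -/
theorem no_positive_supersolution
    (N : ℕ) (hN : 3 ≤ N) (a b p q : ℝ) (ha : -2 < a) (hb : -2 < b)
    (hp : 0 < p) (hq : 0 < q)
    (hcond : p * q ≤ 1 ∨ (1 < p * q ∧
      (N : ℝ) - 2 ≤ max ((2 * (p + 1) + a + b * p) / (p * q - 1))
        ((2 * (q + 1) + b + a * q) / (p * q - 1)))) :
    ¬ ∃ u v : EuclideanSpace ℝ (Fin N) → ℝ,
        Continuous u ∧ Continuous v ∧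
        ContDiffOn ℝ 2 u {(0 : EuclideanSpace ℝ (Fin N))}ᶜ ∧
        ContDiffOn ℝ 2 v {(0 : EuclideanSpace ℝ (Fin N))}ᶜ ∧
        (∀ x, 0 < u x) ∧ (∀ x, 0 < v x) ∧
        (∀ x, x ≠ 0 → ‖x‖ ^ a * v x ^ p ≤ -lap u x) ∧
        (∀ x, x ≠ 0 → ‖x‖ ^ b * u x ^ q ≤ -lap v x) := by
  rintro ⟨u, v, huc, hvc, hu, hv, hupos, hvpos, hlapu, hlapv⟩
  have hcases : (p * q ≤ 1 ∨ 1 < p * q ∧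
      (N : ℝ) - 2 ≤ (2 * (p + 1) + a + b * p) / (p * q - 1)) ∨ (q * p ≤ 1 ∨ 1 < q * p ∧
      (N : ℝ) - 2 ≤ (2 * (q + 1) + b + a * q) / (q * p - 1)) := by
    rw [mul_comm q p]
    rcases hcond with h | ⟨h, h'⟩
    · exact Or.inl (Or.inl h)
    · rcases le_max_iff.1 h' with h' | h'
      · exact Or.inl (Or.inr ⟨h, h'⟩)
      · exact Or.inr (Or.inr ⟨h, h'⟩)
  rcases hcases with h | h
  · exact false_of_positive_supersolution hN ha hb hp hq h huc hvc hu hv hupos hvpos hlapu hlapv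
  · exact false_of_positive_supersolution hN hb ha hq hp h hvc huc hv hu hvpos hupos hlapv hlapu
end

section
/- Let N ≥ 3 be an integer, let a, b > −2 and p, q > 0. Then there exists no radial positive solution (u, v) of the Hardy–Hénon system on ℝ^N if and only if (N+a)/(p+1) + (N+b)/(q+1) > N−2. -/
open MeasureTheory Metric Set Filter

theorem hasFDerivAt_comp_norm {E : Type*} [NormedAddCommGroup E] [InnerProductSpace ℝ E]
    {U : ℝ → ℝ} {U' : ℝ} {x : E} (hx : x ≠ 0) (hU : HasDerivAt U U' ‖x‖) :
    HasFDerivAt (fun y : E => U ‖y‖) ((U' / ‖x‖) • innerSL ℝ x) x := by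
  have hx' : ‖x‖ ≠ 0 := norm_ne_zero_iff.mpr hx
  have hn : HasFDerivAt (fun y : E => ‖y‖) ((1 / ‖x‖) • innerSL ℝ x) x := by
    have h := (hasStrictFDerivAt_norm_sq x).hasFDerivAt.sqrt (by positivity)
    simp only [Real.sqrt_sq (norm_nonneg _)] at h
    convert h using 1
    ext y
    simp
    field_simp
  have h : HasFDerivAt (fun y : E => U ‖y‖) (U' • (1 / ‖x‖) • innerSL ℝ x) x :=
    hU.comp_hasFDerivAt x hn
  rwa [smul_smul, mul_one_div] at h

theorem lap_comp_norm {N : ℕ} {U U₁ : ℝ → ℝ} {U₂ : ℝ} {x : EuclideanSpace ℝ (Fin N)}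
    (hx : x ≠ 0) (hU : ∀ r > 0, HasDerivAt U (U₁ r) r) (hU₁ : HasDerivAt U₁ U₂ ‖x‖) :
    lap (fun y : EuclideanSpace ℝ (Fin N) => U ‖y‖) x
      = U₂ + ((N : ℝ) - 1) / ‖x‖ * U₁ ‖x‖ := by
  have hx' : ‖x‖ ≠ 0 := norm_ne_zero_iff.mpr hx
  obtain ⟨L, hL⟩ : ∃ L : EuclideanSpace ℝ (Fin N) →L[ℝ] EuclideanSpace ℝ (Fin N) →L[ℝ] ℝ,
      ∀ y, L y = innerSL ℝ y := ⟨innerSL ℝ, fun _ => rfl⟩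
  have hev : fderiv ℝ (fun y : EuclideanSpace ℝ (Fin N) => U ‖y‖)
      =ᶠ[nhds x] fun y => (U₁ ‖y‖ / ‖y‖) • L y := by
    filter_upwards [isOpen_ne.mem_nhds hx] with y hy
    rw [hL]
    exact (hasFDerivAt_comp_norm hy (hU _ (norm_pos_iff.mpr hy))).fderiv
  have hφ := hasFDerivAt_comp_norm (U := fun r => U₁ r / r) hx (hU₁.div (hasDerivAt_id _) hx')
  have hd := (hφ.fun_smul L.hasFDerivAt).fderiv
  have hterm : ∀ i : Fin N, iteratedFDeriv ℝ 2 (fun y : EuclideanSpace ℝ (Fin N) => U ‖y‖) x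
      ![EuclideanSpace.single i 1, EuclideanSpace.single i 1]
      = U₁ ‖x‖ / ‖x‖ + (U₂ * ‖x‖ - U₁ ‖x‖) / ‖x‖ ^ 3 * (x i) ^ 2 := by
    intro i
    rw [iteratedFDeriv_two_apply, hev.fderiv_eq, hd]
    simp [hL, innerSL_apply_apply, EuclideanSpace.inner_single_right]
    field_simp
  have hsum : ∑ i, (x i) ^ 2 = ‖x‖ ^ 2 := by
    simp [EuclideanSpace.norm_sq_eq]
  simp only [lap, hterm, Finset.sum_add_distrib, ← Finset.mul_sum, hsum]
  simp
  field_simp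
  ring

/-- The Pohozaev functional of a radial solution `(U, V)` with fluxes `P = r ^ (n - 1) * U'`
and `Q = r ^ (n - 1) * V'`. -/
noncomputable def pohozaev (n a b p q d : ℝ) (U V P Q : ℝ → ℝ) (r : ℝ) : ℝ :=
  r ^ (2 - n) * (P r * Q r) + r ^ (n + b) * U r ^ (q + 1) / (q + 1)
    + r ^ (n + a) * V r ^ (p + 1) / (p + 1)
    + ((n + a) / (p + 1) + d) * (P r * V r) + ((n + b) / (q + 1) + d) * (Q r * U r)

theorem hasDerivAt_pohozaev {n a b p q d r : ℝ} {U V P Q : ℝ → ℝ} (hp : 0 < p) (hq : 0 < q)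
    (hr : 0 < r) (hd : (n + a) / (p + 1) + (n + b) / (q + 1) + 2 * d = n - 2)
    (hUr : 0 < U r) (hVr : 0 < V r)
    (hU : HasDerivAt U (r ^ (1 - n) * P r) r) (hV : HasDerivAt V (r ^ (1 - n) * Q r) r)
    (hP : HasDerivAt P (-(r ^ (n - 1 + a) * V r ^ p)) r)
    (hQ : HasDerivAt Q (-(r ^ (n - 1 + b) * U r ^ q)) r) :
    HasDerivAt (pohozaev n a b p q d U V P Q)
      (-d * (r ^ (n + a - 1) * V r ^ (p + 1) + r ^ (n + b - 1) * U r ^ (q + 1))) r := by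
  have hpow : ∀ c : ℝ, HasDerivAt (fun s : ℝ => s ^ c) (c * r ^ (c - 1)) r := fun c =>
    Real.hasDerivAt_rpow_const (Or.inl hr.ne')
  have h₁ := (hpow (2 - n)).fun_mul (hP.fun_mul hQ)
  have h₂ := ((hpow (n + b)).fun_mul (hU.rpow_const (p := q + 1) (Or.inl hUr.ne'))).div_const
    (q + 1)
  have h₃ := ((hpow (n + a)).fun_mul (hV.rpow_const (p := p + 1) (Or.inl hVr.ne'))).div_const
    (p + 1)
  have h₄ := (hP.fun_mul hV).const_mul ((n + a) / (p + 1) + d)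
  have h₅ := (hQ.fun_mul hU).const_mul ((n + b) / (q + 1) + d)
  have h := (((h₁.fun_add h₂).fun_add h₃).fun_add h₄).fun_add h₅
  refine h.congr_deriv ?_
  have hp1 : p + 1 ≠ 0 := by positivity
  have hq1 : q + 1 ≠ 0 := by positivity
  obtain ⟨A, hA⟩ : ∃ A, A = (n + a) / (p + 1) := ⟨_, rfl⟩
  obtain ⟨B, hB⟩ : ∃ B, B = (n + b) / (q + 1) := ⟨_, rfl⟩
  have hA' : n + a = A * (p + 1) := by rw [hA]; field_simp
  have hB' : n + b = B * (q + 1) := by rw [hB]; field_simp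
  rw [← hA, ← hB] at hd ⊢
  have e₁ : r ^ (2 - n) = r ^ 2 / r ^ n := by rw [Real.rpow_sub hr]; simp
  have e₂ : r ^ (2 - n - 1) = r / r ^ n := by
    rw [show 2 - n - 1 = 1 - n by ring, Real.rpow_sub hr]; simp
  have e₃ : r ^ (1 - n) = r / r ^ n := by rw [Real.rpow_sub hr]; simp
  have e₄ : ∀ c, r ^ (n - 1 + c) = r ^ n * r ^ c / r := fun c => by
    rw [Real.rpow_add hr, Real.rpow_sub hr]; simp; ring
  have e₅ : ∀ c, r ^ (n + c - 1) = r ^ n * r ^ c / r := fun c => by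
    rw [Real.rpow_sub hr, Real.rpow_add hr]; simp
  simp only [e₁, e₂, e₃, e₄, e₅, Real.rpow_add hr n, Real.rpow_add_one hUr.ne',
    Real.rpow_add_one hVr.ne', add_sub_cancel_right]
  have hn : r ^ n ≠ 0 := (Real.rpow_pos_of_pos hr n).ne'
  have hr' := hr.ne'
  generalize r ^ n = X at *
  generalize r ^ a = Y at *
  generalize r ^ b = Z at *
  generalize U r ^ q = S at *
  generalize V r ^ p = T at *
  rw [hA', hB']
  field_simp
  linear_combination (P r * Q r * r ^ 2) * hd

theorem exists_flux_lt {n : ℝ} {U P : ℝ → ℝ} (hn : 2 < n) (hc : ContinuousOn U (Ici 0))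
    (hU : ∀ r > 0, HasDerivAt U (r ^ (1 - n) * P r) r) {ε η : ℝ} (hε : 0 < ε) (hη : 0 < η) :
    ∃ s ∈ Ioo 0 η, |P s| < ε := by
  have h2n : (0 : ℝ) < 2 ^ n := by positivity
  have hlim := Metric.continuousOn_iff.mp hc 0 self_mem_Ici (ε / 2 ^ n / 2) (by positivity)
  obtain ⟨δ, hδ, hlim⟩ := hlim
  obtain ⟨r, hr, hr1, hrδ, hrη⟩ : ∃ r : ℝ, 0 < r ∧ r ≤ 1 ∧ 2 * r < δ ∧ 2 * r < η := by
    refine ⟨min 1 (min δ η) / 3, by positivity, ?_, ?_, ?_⟩ <;>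
    · have h₁ : min 1 (min δ η) ≤ 1 := min_le_left _ _
      have h₂ : min 1 (min δ η) ≤ δ := (min_le_right _ _).trans (min_le_left _ _)
      have h₃ : min 1 (min δ η) ≤ η := (min_le_right _ _).trans (min_le_right _ _)
      linarith
  obtain ⟨s, ⟨hs₁, hs₂⟩, hs⟩ := exists_hasDerivAt_eq_slope U (fun r => r ^ (1 - n) * P r)
    (show r < 2 * r by linarith) (hc.mono fun x hx => hr.le.trans hx.1)
    (fun x hx => hU x (hr.trans hx.1))
  have hs0 : 0 < s := hr.trans hs₁
  refine ⟨s, ⟨hs0, hs₂.trans hrη⟩, ?_⟩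
  have hUr := hlim r hr.le (by rw [Real.dist_eq, sub_zero, abs_of_pos hr]; linarith)
  have hU2r := hlim (2 * r) (mem_Ici.mpr (by linarith))
    (by rw [Real.dist_eq, sub_zero, abs_of_pos (by linarith)]; linarith)
  rw [Real.dist_eq] at hUr hU2r
  have hdiff : |U (2 * r) - U r| < ε / 2 ^ n := by
    rw [abs_lt] at *
    constructor <;> linarith [hUr.1, hUr.2, hU2r.1, hU2r.2]
  have hPs : P s = s ^ (n - 1) * ((U (2 * r) - U r) / r) := by
    have : (2 * r - r) = r := by ring
    rw [this] at hs
    rw [← hs, ← mul_assoc, ← Real.rpow_add hs0]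
    simp
  have hsle : s ^ (n - 1) ≤ 2 ^ n * r := by
    calc s ^ (n - 1) ≤ (2 * r) ^ (n - 1) :=
          Real.rpow_le_rpow hs0.le hs₂.le (by linarith)
      _ = 2 ^ (n - 1) * r ^ (n - 1) := Real.mul_rpow (by norm_num) hr.le
      _ ≤ 2 ^ n * r := by
          refine mul_le_mul (Real.rpow_le_rpow_of_exponent_le (by norm_num) (by linarith)) ?_
            (by positivity) h2n.le
          simpa using Real.rpow_le_rpow_of_exponent_ge hr hr1 (show (1 : ℝ) ≤ n - 1 by linarith)
  rw [hPs, abs_mul, abs_div, abs_of_pos hr, abs_of_pos (by positivity)]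
  calc s ^ (n - 1) * (|U (2 * r) - U r| / r) ≤ 2 ^ n * r * (|U (2 * r) - U r| / r) := by gcongr
    _ = 2 ^ n * |U (2 * r) - U r| := by field_simp
    _ < 2 ^ n * (ε / 2 ^ n) := by gcongr
    _ = ε := by field_simp

theorem tendsto_flux {n : ℝ} {U P : ℝ → ℝ} (hn : 2 < n) (hc : ContinuousOn U (Ici 0))
    (hU : ∀ r > 0, HasDerivAt U (r ^ (1 - n) * P r) r) (hP : StrictAntiOn P (Ioi 0)) :
    Tendsto P (nhdsWithin 0 (Ioi 0)) (nhds 0) := by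
  rw [Metric.tendsto_nhds]
  intro ε hε
  obtain ⟨s, hs, hsP⟩ := exists_flux_lt hn hc hU hε one_pos
  filter_upwards [Ioo_mem_nhdsGT hs.1] with r hr
  obtain ⟨t, ht, htP⟩ := exists_flux_lt hn hc hU hε hr.1
  have h₁ := hP hr.1 hs.1 hr.2
  have h₂ := hP ht.1 hr.1 ht.2
  rw [Real.dist_eq, sub_zero, abs_lt] at *
  exact ⟨hsP.1.trans h₁, h₂.trans htP.2⟩

theorem flux_neg {n : ℝ} {U P : ℝ → ℝ} (hn : 2 < n) (hc : ContinuousOn U (Ici 0))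
    (hU : ∀ r > 0, HasDerivAt U (r ^ (1 - n) * P r) r) (hP : StrictAntiOn P (Ioi 0))
    {r : ℝ} (hr : 0 < r) : P r < 0 := by
  have hr2 : 0 < r / 2 := by positivity
  have h₁ : P (r / 2) ≤ 0 := by
    refine ge_of_tendsto (tendsto_flux hn hc hU hP) ?_
    filter_upwards [Ioo_mem_nhdsGT hr2] with s hs using (hP hs.1 hr2 hs.2).le
  exact (hP hr2 hr (by linarith)).trans_le h₁

theorem strictAntiOn_of_flux_neg {n : ℝ} {U P : ℝ → ℝ}
    (hU : ∀ r > 0, HasDerivAt U (r ^ (1 - n) * P r) r) (hP : ∀ r > 0, P r < 0) :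
    StrictAntiOn U (Ioi 0) := by
  refine strictAntiOn_of_deriv_neg (convex_Ioi 0)
    (fun r hr => (hU r hr).continuousAt.continuousWithinAt) fun r hr => ?_
  rw [interior_Ioi] at hr
  rw [(hU r hr).deriv]
  exact mul_neg_of_pos_of_neg (Real.rpow_pos_of_pos hr _) (hP r hr)

theorem strictAntiOn_flux {n a : ℝ} {P f : ℝ → ℝ} (hf : ∀ r > 0, 0 < f r)
    (hP : ∀ r > 0, HasDerivAt P (-(r ^ (n - 1 + a) * f r)) r) : StrictAntiOn P (Ioi 0) := by
  refine strictAntiOn_of_deriv_neg (convex_Ioi 0)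
    (fun r hr => (hP r hr).continuousAt.continuousWithinAt) fun r hr => ?_
  rw [interior_Ioi] at hr
  rw [(hP r hr).deriv]
  exact neg_neg_of_pos (mul_pos (Real.rpow_pos_of_pos hr _) (hf r hr))

theorem neg_flux_le {n a : ℝ} {U P f : ℝ → ℝ} (hf : ∀ r > 0, 0 < f r) (hUpos : ∀ r > 0, 0 < U r)
    (hU : ∀ r > 0, HasDerivAt U (r ^ (1 - n) * P r) r)
    (hP : ∀ r > 0, HasDerivAt P (-(r ^ (n - 1 + a) * f r)) r) (hn : 2 < n) {r : ℝ} (hr : 0 < r) :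
    -(r ^ (2 - n) * P r) ≤ (n - 2) * U r := by
  by_contra! hlt
  obtain ⟨c, hc, hcr⟩ : ∃ c > 0, r ^ (2 - n) * P r + (n - 2) * U r = -c :=
    ⟨-(r ^ (2 - n) * P r + (n - 2) * U r), by linarith, by ring⟩
  have hD : ∀ s > 0, HasDerivAt (fun s => s ^ (2 - n) * P s + (n - 2) * U s)
      (-(s ^ (1 + a) * f s)) s := by
    intro s hs
    have h := ((Real.hasDerivAt_rpow_const (p := 2 - n) (Or.inl hs.ne')).fun_mul
      (hP s hs)).fun_add ((hU s hs).const_mul (n - 2))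
    refine h.congr_deriv ?_
    have hpow : s ^ (1 + a) = s ^ (2 - n) * s ^ (n - 1 + a) := by
      rw [← Real.rpow_add hs]
      ring_nf
    rw [hpow, show 2 - n - 1 = 1 - n by ring]
    ring
  have hDanti : AntitoneOn (fun s => s ^ (2 - n) * P s + (n - 2) * U s) (Ioi 0) := by
    refine antitoneOn_of_deriv_nonpos (convex_Ioi 0)
      (fun s hs => (hD s hs).continuousAt.continuousWithinAt)
      (fun s hs => (hD s (by simpa using hs)).differentiableAt.differentiableWithinAt)
      fun s hs => ?_
    rw [interior_Ioi] at hs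
    rw [(hD s hs).deriv]
    exact neg_nonpos.mpr (mul_nonneg (Real.rpow_nonneg (le_of_lt hs) _) (hf s hs).le)
  have hL : ∀ s > 0, HasDerivAt (fun s => U s + c * Real.log s)
      (s ^ (1 - n) * P s + c * s⁻¹) s := fun s hs =>
    (hU s hs).fun_add ((Real.hasDerivAt_log hs.ne').const_mul c)
  have hLanti : AntitoneOn (fun s => U s + c * Real.log s) (Ici r) := by
    refine antitoneOn_of_deriv_nonpos (convex_Ici r)
      (fun s hs => (hL s (hr.trans_le hs)).continuousAt.continuousWithinAt)
      (fun s hs => (hL s ?_).differentiableAt.differentiableWithinAt) fun s hs => ?_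
    · rw [interior_Ici] at hs
      exact hr.trans hs
    · rw [interior_Ici] at hs
      have hs0 : 0 < s := hr.trans hs
      have h₁ := hDanti hr hs0 (le_of_lt hs)
      have h₂ := mul_pos (sub_pos.mpr hn) (hUpos s hs0)
      have h₃ : s ^ (2 - n) = s ^ (1 - n) * s := by
        rw [← Real.rpow_add_one hs0.ne']; ring_nf
      rw [(hL s hs0).deriv]
      simp only [h₃, hcr] at h₁
      have h₄ : s ^ (1 - n) * P s + c * s⁻¹ = (s ^ (1 - n) * s * P s + c) / s := by
        field_simp
      rw [h₄]
      exact div_nonpos_of_nonpos_of_nonneg (by linarith) hs0.le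
  obtain ⟨t, ht, htlog⟩ : ∃ t ≥ r, c * Real.log t = c * Real.log r + U r := by
    refine ⟨r * Real.exp (U r / c), ?_, ?_⟩
    · exact le_mul_of_one_le_right hr.le (Real.one_le_exp (div_nonneg (hUpos r hr).le hc.le))
    · rw [Real.log_mul hr.ne' (Real.exp_pos _).ne', Real.log_exp]
      field_simp
  have h₁ := hLanti self_mem_Ici ht ht
  have h₂ := hUpos t (hr.trans_le ht)
  simp only at h₁
  linarith

theorem rpow_mul_le_neg_flux {n a : ℝ} {P f : ℝ → ℝ} (hna : 0 < n + a)
    (hf : AntitoneOn f (Ioi 0)) (hPneg : ∀ r > 0, P r < 0)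
    (hP : ∀ r > 0, HasDerivAt P (-(r ^ (n - 1 + a) * f r)) r) {r : ℝ} (hr : 0 < r) :
    r ^ (n + a) * f r ≤ -((n + a) * P r) := by
  have hφ : ∀ s > 0, HasDerivAt (fun s => -((n + a) * P s) - s ^ (n + a) * f r)
      ((n + a) * s ^ (n - 1 + a) * (f s - f r)) s := by
    intro s hs
    have h := ((hP s hs).const_mul (n + a)).fun_neg.fun_sub
      ((Real.hasDerivAt_rpow_const (p := n + a) (Or.inl hs.ne')).mul_const (f r))
    refine h.congr_deriv ?_
    rw [show n + a - 1 = n - 1 + a by ring]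
    ring
  have hmono : MonotoneOn (fun s => -((n + a) * P s) - s ^ (n + a) * f r) (Ioc 0 r) := by
    refine monotoneOn_of_deriv_nonneg (convex_Ioc 0 r)
      (fun s hs => (hφ s hs.1).continuousAt.continuousWithinAt)
      (fun s hs => (hφ s ?_).differentiableAt.differentiableWithinAt) fun s hs => ?_
    · exact (interior_subset hs).1
    · have hs' := interior_subset hs
      rw [(hφ s hs'.1).deriv]
      exact mul_nonneg (mul_nonneg hna.le (Real.rpow_nonneg hs'.1.le _))
        (sub_nonneg.mpr (hf hs'.1 hr hs'.2))
  have hlim : Tendsto (fun s : ℝ => -(s ^ (n + a) * f r)) (nhdsWithin 0 (Ioi 0)) (nhds 0) := by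
    have h := ((Real.continuousAt_rpow_const 0 (n + a) (Or.inr hna.le)).tendsto.mul_const
      (f r)).neg
    rw [Real.zero_rpow hna.ne', zero_mul, neg_zero] at h
    exact h.mono_left nhdsWithin_le_nhds
  have h := le_of_tendsto (b := -((n + a) * P r) - r ^ (n + a) * f r) hlim (by
    filter_upwards [Ioo_mem_nhdsGT hr] with s hs
    have h₁ := hmono ⟨hs.1, hs.2.le⟩ ⟨hr, le_rfl⟩ hs.2.le
    have h₂ := mul_neg_of_pos_of_neg hna (hPneg s hs.1)
    simp only at h₁
    linarith)
  linarith

theorem rpow_mul_le_of_flux {n a : ℝ} {U P f : ℝ → ℝ} (hn : 2 < n) (hna : 0 < n + a)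
    (hf : ∀ r > 0, 0 < f r) (hfa : AntitoneOn f (Ioi 0)) (hUpos : ∀ r > 0, 0 < U r)
    (hPneg : ∀ r > 0, P r < 0) (hU : ∀ r > 0, HasDerivAt U (r ^ (1 - n) * P r) r)
    (hP : ∀ r > 0, HasDerivAt P (-(r ^ (n - 1 + a) * f r)) r) {r : ℝ} (hr : 0 < r) :
    r ^ (2 + a) * f r ≤ (n + a) * (n - 2) * U r := by
  have h₁ := rpow_mul_le_neg_flux hna hfa hPneg hP hr
  have h₂ := neg_flux_le hf hUpos hU hP hn hr
  have h₃ : r ^ (2 + a) = r ^ (2 - n) * r ^ (n + a) := by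
    rw [← Real.rpow_add hr]
    ring_nf
  calc r ^ (2 + a) * f r = r ^ (2 - n) * (r ^ (n + a) * f r) := by rw [h₃]; ring
    _ ≤ r ^ (2 - n) * -((n + a) * P r) := by gcongr
    _ = (n + a) * -(r ^ (2 - n) * P r) := by ring
    _ ≤ (n + a) * ((n - 2) * U r) := by gcongr
    _ = (n + a) * (n - 2) * U r := by ring

theorem no_positive_entire_solution {n a b p q : ℝ} {U V P Q : ℝ → ℝ} (hn : 2 < n)
    (ha : -2 < a) (hb : -2 < b) (hp : 0 < p) (hq : 0 < q)
    (hsub : n - 2 < (n + a) / (p + 1) + (n + b) / (q + 1))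
    (hUc : ContinuousOn U (Ici 0)) (hVc : ContinuousOn V (Ici 0))
    (hUpos : ∀ r > 0, 0 < U r) (hVpos : ∀ r > 0, 0 < V r)
    (hU : ∀ r > 0, HasDerivAt U (r ^ (1 - n) * P r) r)
    (hV : ∀ r > 0, HasDerivAt V (r ^ (1 - n) * Q r) r)
    (hP : ∀ r > 0, HasDerivAt P (-(r ^ (n - 1 + a) * V r ^ p)) r)
    (hQ : ∀ r > 0, HasDerivAt Q (-(r ^ (n - 1 + b) * U r ^ q)) r) : False := by
  have hna : 0 < n + a := by linarith
  have hnb : 0 < n + b := by linarith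
  have hn2 : 0 < n - 2 := by linarith
  have hUq : ∀ r > 0, 0 < U r ^ q := fun r hr => Real.rpow_pos_of_pos (hUpos r hr) q
  have hVp : ∀ r > 0, 0 < V r ^ p := fun r hr => Real.rpow_pos_of_pos (hVpos r hr) p
  have hPanti := strictAntiOn_flux hVp hP
  have hQanti := strictAntiOn_flux hUq hQ
  have hPneg : ∀ r > 0, P r < 0 := fun r hr => flux_neg hn hUc hU hPanti hr
  have hQneg : ∀ r > 0, Q r < 0 := fun r hr => flux_neg hn hVc hV hQanti hr
  have hUanti := strictAntiOn_of_flux_neg hU hPneg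
  have hVanti := strictAntiOn_of_flux_neg hV hQneg
  have hUqa : AntitoneOn (fun r => U r ^ q) (Ioi 0) := fun r hr s hs hrs =>
    Real.rpow_le_rpow (hUpos s hs).le (hUanti.antitoneOn hr hs hrs) hq.le
  have hVpa : AntitoneOn (fun r => V r ^ p) (Ioi 0) := fun r hr s hs hrs =>
    Real.rpow_le_rpow (hVpos s hs).le (hVanti.antitoneOn hr hs hrs) hp.le
  obtain ⟨d, hd⟩ : ∃ d, (n + a) / (p + 1) + (n + b) / (q + 1) + 2 * d = n - 2 :=
    ⟨(n - 2 - ((n + a) / (p + 1) + (n + b) / (q + 1))) / 2, by ring⟩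
  have hd0 : d < 0 := by linarith
  have hE : ∀ r > 0, HasDerivAt (pohozaev n a b p q d U V P Q)
      (-d * (r ^ (n + a - 1) * V r ^ (p + 1) + r ^ (n + b - 1) * U r ^ (q + 1))) r :=
    fun r hr => hasDerivAt_pohozaev hp hq hr hd (hUpos r hr) (hVpos r hr) (hU r hr) (hV r hr)
      (hP r hr) (hQ r hr)
  have hEmono : StrictMonoOn (pohozaev n a b p q d U V P Q) (Ioi 0) := by
    refine strictMonoOn_of_deriv_pos (convex_Ioi 0)
      (fun r hr => (hE r hr).continuousAt.continuousWithinAt) fun r hr => ?_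
    rw [interior_Ioi] at hr
    have hr0 : 0 < r := hr
    have hUr := hUpos r hr
    have hVr := hVpos r hr
    rw [(hE r hr).deriv]
    exact mul_pos (neg_pos.mpr hd0) (by positivity)
  have hE1 : 0 ≤ pohozaev n a b p q d U V P Q 1 := by
    have hlim : Tendsto (fun r => ((n + a) / (p + 1) + d) * (P r * V r)
        + ((n + b) / (q + 1) + d) * (Q r * U r)) (nhdsWithin 0 (Ioi 0)) (nhds 0) := by
      have hU0 := (hUc 0 self_mem_Ici).tendsto.mono_left (nhdsWithin_mono 0 Ioi_subset_Ici_self)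
      have hV0 := (hVc 0 self_mem_Ici).tendsto.mono_left (nhdsWithin_mono 0 Ioi_subset_Ici_self)
      have h := (((tendsto_flux hn hUc hU hPanti).mul hV0).const_mul ((n + a) / (p + 1) + d)).add
        (((tendsto_flux hn hVc hV hQanti).mul hU0).const_mul ((n + b) / (q + 1) + d))
      simpa using h
    refine le_of_tendsto hlim ?_
    filter_upwards [Ioo_mem_nhdsGT one_pos] with r hr
    have hr0 : 0 < r := hr.1
    have h₁ := hEmono hr.1 (mem_Ioi.mpr one_pos) hr.2
    have h₂ := mul_pos_of_neg_of_neg (hPneg r hr.1) (hQneg r hr.1)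
    have hUr := hUpos r hr.1
    have hVr := hVpos r hr.1
    have h₃ : 0 < r ^ (2 - n) * (P r * Q r) := by positivity
    have h₄ : 0 < r ^ (n + b) * U r ^ (q + 1) / (q + 1) := by positivity
    have h₅ : 0 < r ^ (n + a) * V r ^ (p + 1) / (p + 1) := by positivity
    unfold pohozaev at h₁ ⊢
    linarith
  have hE2 : 0 < pohozaev n a b p q d U V P Q 2 :=
    hE1.trans_lt (hEmono (mem_Ioi.mpr one_pos) (mem_Ioi.mpr two_pos) one_lt_two)
  have hK₁ : ∀ r > 0, r ^ (2 + a) * V r ^ p ≤ (n + a) * (n - 2) * U r := fun r hr =>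
    rpow_mul_le_of_flux hn hna hVp hVpa hUpos hPneg hU hP hr
  have hK₂ : ∀ r > 0, r ^ (2 + b) * U r ^ q ≤ (n + b) * (n - 2) * V r := fun r hr =>
    rpow_mul_le_of_flux hn hnb hUq hUqa hVpos hQneg hV hQ hr
  obtain ⟨C, hC, hEC⟩ : ∃ C > 0, ∀ r > 0,
      pohozaev n a b p q d U V P Q r ≤ C * (r ^ (n - 2) * (U r * V r)) := by
    refine ⟨(n - 2) ^ 2 + (n + b) * (n - 2) / (q + 1) + (n + a) * (n - 2) / (p + 1)
      + |(n + a) / (p + 1) + d| * (n - 2) + |(n + b) / (q + 1) + d| * (n - 2), by positivity,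
      fun r hr => ?_⟩
    have hUr := hUpos r hr
    have hVr := hVpos r hr
    have hX : 0 < r ^ (n - 2) := Real.rpow_pos_of_pos hr _
    have hX' : r ^ (2 - n) = (r ^ (n - 2))⁻¹ := by
      rw [← Real.rpow_neg hr.le]
      ring_nf
    have hPU : -P r ≤ (n - 2) * (r ^ (n - 2) * U r) := by
      have h := neg_flux_le hVp hUpos hU hP hn hr
      rw [hX', ← mul_neg, inv_mul_le_iff₀ hX] at h
      linarith
    have hQV : -Q r ≤ (n - 2) * (r ^ (n - 2) * V r) := by
      have h := neg_flux_le hUq hVpos hV hQ hn hr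
      rw [hX', ← mul_neg, inv_mul_le_iff₀ hX] at h
      linarith
    have t₁ : r ^ (2 - n) * (P r * Q r) ≤ (n - 2) ^ 2 * (r ^ (n - 2) * (U r * V r)) := by
      rw [hX', inv_mul_le_iff₀ hX, ← neg_mul_neg]
      refine (mul_le_mul hPU hQV (neg_nonneg.mpr (hQneg r hr).le) (by positivity)).trans_eq ?_
      ring
    have t₂ : r ^ (n + b) * U r ^ (q + 1) / (q + 1)
        ≤ (n + b) * (n - 2) / (q + 1) * (r ^ (n - 2) * (U r * V r)) := by
      rw [show n + b = (n - 2) + (2 + b) by ring, Real.rpow_add hr, Real.rpow_add_one hUr.ne']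
      calc r ^ (n - 2) * r ^ (2 + b) * (U r ^ q * U r) / (q + 1)
          = r ^ (n - 2) * U r * (r ^ (2 + b) * U r ^ q) / (q + 1) := by ring
        _ ≤ r ^ (n - 2) * U r * ((n + b) * (n - 2) * V r) / (q + 1) := by
            have := hK₂ r hr
            gcongr
        _ = (n - 2 + (2 + b)) * (n - 2) / (q + 1) * (r ^ (n - 2) * (U r * V r)) := by ring
    have t₃ : r ^ (n + a) * V r ^ (p + 1) / (p + 1)
        ≤ (n + a) * (n - 2) / (p + 1) * (r ^ (n - 2) * (U r * V r)) := by
      rw [show n + a = (n - 2) + (2 + a) by ring, Real.rpow_add hr, Real.rpow_add_one hVr.ne']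
      calc r ^ (n - 2) * r ^ (2 + a) * (V r ^ p * V r) / (p + 1)
          = r ^ (n - 2) * V r * (r ^ (2 + a) * V r ^ p) / (p + 1) := by ring
        _ ≤ r ^ (n - 2) * V r * ((n + a) * (n - 2) * U r) / (p + 1) := by
            have := hK₁ r hr
            gcongr
        _ = (n - 2 + (2 + a)) * (n - 2) / (p + 1) * (r ^ (n - 2) * (U r * V r)) := by ring
    have t₄ : ((n + a) / (p + 1) + d) * (P r * V r)
        ≤ |(n + a) / (p + 1) + d| * (n - 2) * (r ^ (n - 2) * (U r * V r)) := by
      refine (le_abs_self _).trans ?_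
      rw [abs_mul, abs_mul, abs_of_neg (hPneg r hr), abs_of_pos hVr, mul_assoc]
      refine mul_le_mul_of_nonneg_left ?_ (abs_nonneg _)
      refine (mul_le_mul_of_nonneg_right hPU hVr.le).trans_eq ?_
      ring
    have t₅ : ((n + b) / (q + 1) + d) * (Q r * U r)
        ≤ |(n + b) / (q + 1) + d| * (n - 2) * (r ^ (n - 2) * (U r * V r)) := by
      refine (le_abs_self _).trans ?_
      rw [abs_mul, abs_mul, abs_of_neg (hQneg r hr), abs_of_pos hUr, mul_assoc]
      refine mul_le_mul_of_nonneg_left ?_ (abs_nonneg _)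
      refine (mul_le_mul_of_nonneg_right hQV hUr.le).trans_eq ?_
      ring
    unfold pohozaev
    linarith
  have hlog₁ : ∀ r > 0, (2 + a) * Real.log r + p * Real.log (V r)
      ≤ Real.log ((n + a) * (n - 2)) + Real.log (U r) := by
    intro r hr
    have h := Real.log_le_log (mul_pos (Real.rpow_pos_of_pos hr _) (hVp r hr)) (hK₁ r hr)
    rwa [Real.log_mul (Real.rpow_pos_of_pos hr _).ne' (hVp r hr).ne', Real.log_rpow hr,
      Real.log_rpow (hVpos r hr), Real.log_mul (mul_pos hna hn2).ne' (hUpos r hr).ne'] at h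
  have hlog₂ : ∀ r > 0, (2 + b) * Real.log r + q * Real.log (U r)
      ≤ Real.log ((n + b) * (n - 2)) + Real.log (V r) := by
    intro r hr
    have h := Real.log_le_log (mul_pos (Real.rpow_pos_of_pos hr _) (hUq r hr)) (hK₂ r hr)
    rwa [Real.log_mul (Real.rpow_pos_of_pos hr _).ne' (hUq r hr).ne', Real.log_rpow hr,
      Real.log_rpow (hUpos r hr), Real.log_mul (mul_pos hnb hn2).ne' (hVpos r hr).ne'] at h
  have hlog₃ : ∀ r ≥ 2, Real.log (pohozaev n a b p q d U V P Q 2)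
      ≤ Real.log C + ((n - 2) * Real.log r + (Real.log (U r) + Real.log (V r))) := by
    intro r hr
    have hr0 : 0 < r := two_pos.trans_le hr
    have h := Real.log_le_log hE2
      ((hEmono.monotoneOn (mem_Ioi.mpr two_pos) (mem_Ioi.mpr hr0) hr).trans (hEC r hr0))
    have hUr := hUpos r hr0
    have hVr := hVpos r hr0
    rwa [Real.log_mul hC.ne' (by positivity), Real.log_mul (by positivity) (by positivity),
      Real.log_rpow hr0, Real.log_mul hUr.ne' hVr.ne'] at h
  obtain ⟨κ, hκ, c, hc⟩ : ∃ κ > 0, ∃ c : ℝ, ∀ r ≥ 2, κ * Real.log r ≤ c := by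
    have hcomb : ∀ r > 0, ((q + 1) * (2 + a) + (p + 1) * (2 + b)) * Real.log r
        + (p * q - 1) * (Real.log (U r) + Real.log (V r))
        ≤ (q + 1) * Real.log ((n + a) * (n - 2)) + (p + 1) * Real.log ((n + b) * (n - 2)) := by
      intro r hr
      have h₁ := mul_le_mul_of_nonneg_left (hlog₁ r hr) (show 0 ≤ q + 1 by positivity)
      have h₂ := mul_le_mul_of_nonneg_left (hlog₂ r hr) (show 0 ≤ p + 1 by positivity)
      linarith
    rcases le_total 1 (p * q) with hpq | hpq
    · refine ⟨(q + 1) * (2 + a) + (p + 1) * (2 + b) - (p * q - 1) * (n - 2), ?_,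
        (q + 1) * Real.log ((n + a) * (n - 2)) + (p + 1) * Real.log ((n + b) * (n - 2))
        - (p * q - 1) * (Real.log (pohozaev n a b p q d U V P Q 2) - Real.log C), fun r hr => ?_⟩
      · rw [div_add_div _ _ (by positivity) (by positivity), lt_div_iff₀ (by positivity)] at hsub
        linarith
      · have h₁ := mul_le_mul_of_nonneg_left (hlog₃ r hr) (sub_nonneg.mpr hpq)
        have h₂ := hcomb r (two_pos.trans_le hr)
        linarith
    · refine ⟨(q + 1) * (2 + a) + (p + 1) * (2 + b), ?_,
        (q + 1) * Real.log ((n + a) * (n - 2)) + (p + 1) * Real.log ((n + b) * (n - 2))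
        + (1 - p * q) * (Real.log (U 1) + Real.log (V 1)), fun r hr => ?_⟩
      · have h₁ : 0 < 2 + a := by linarith
        have h₂ : 0 < 2 + b := by linarith
        positivity
      · have hr0 : 0 < r := two_pos.trans_le hr
        have hr1 : 1 ≤ r := one_le_two.trans hr
        have h₁ := Real.log_le_log (hUpos r hr0) (hUanti.antitoneOn (mem_Ioi.mpr one_pos) hr0 hr1)
        have h₂ := Real.log_le_log (hVpos r hr0) (hVanti.antitoneOn (mem_Ioi.mpr one_pos) hr0 hr1)
        have h₃ := mul_le_mul_of_nonneg_left (add_le_add h₁ h₂) (sub_nonneg.mpr hpq)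
        have h₄ := hcomb r hr0
        linarith
  have h := hc (Real.exp (max 1 (|c| / κ + 1))) ?_
  · rw [Real.log_exp] at h
    have h₁ := mul_le_mul_of_nonneg_left (le_max_right 1 (|c| / κ + 1)) hκ.le
    rw [mul_add, mul_div_cancel₀ _ hκ.ne'] at h₁
    linarith [le_abs_self c]
  · have h₁ := Real.add_one_le_exp (max 1 (|c| / κ + 1))
    have h₂ := le_max_left 1 (|c| / κ + 1)
    show (2 : ℝ) ≤ _
    linarith

theorem contDiffOn_two_of_flux {n a : ℝ} {U P F : ℝ → ℝ}
    (hU : ∀ r > 0, HasDerivAt U (r ^ (1 - n) * P r) r)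
    (hP : ∀ r > 0, HasDerivAt P (-(r ^ (n - 1 + a) * F r)) r) (hF : ContinuousOn F (Ioi 0)) :
    ContDiffOn ℝ 2 U (Ioi 0) := by
  have hpow : ∀ c : ℝ, ContDiffOn ℝ 1 (fun r : ℝ => r ^ c) (Ioi 0) := fun c =>
    contDiffOn_id.rpow_const_of_ne fun r hr => (ne_of_gt hr : r ≠ 0)
  have hP1 : ContDiffOn ℝ 1 P (Ioi 0) := by
    rw [show (1 : WithTop ℕ∞) = 0 + 1 by simp, contDiffOn_succ_iff_deriv_of_isOpen isOpen_Ioi]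
    refine ⟨fun r hr => (hP r hr).differentiableAt.differentiableWithinAt, by simp, ?_⟩
    rw [contDiffOn_zero]
    exact (((hpow (n - 1 + a)).continuousOn.mul hF).neg).congr fun r hr => (hP r hr).deriv
  rw [show (2 : WithTop ℕ∞) = 1 + 1 by norm_num, contDiffOn_succ_iff_deriv_of_isOpen isOpen_Ioi]
  refine ⟨fun r hr => (hU r hr).differentiableAt.differentiableWithinAt, by simp, ?_⟩
  exact ((hpow (1 - n)).mul hP1).congr fun r hr => (hU r hr).deriv

theorem lap_eq_of_flux {N : ℕ} {a : ℝ} {U P F : ℝ → ℝ}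
    (hU : ∀ r > 0, HasDerivAt U (r ^ (1 - (N : ℝ)) * P r) r)
    (hP : ∀ r > 0, HasDerivAt P (-(r ^ ((N : ℝ) - 1 + a) * F r)) r)
    {x : EuclideanSpace ℝ (Fin N)} (hx : x ≠ 0) :
    lap (fun y : EuclideanSpace ℝ (Fin N) => U ‖y‖) x = -(‖x‖ ^ a * F ‖x‖) := by
  have hr : 0 < ‖x‖ := norm_pos_iff.mpr hx
  have h := (Real.hasDerivAt_rpow_const (p := 1 - (N : ℝ)) (Or.inl hr.ne')).fun_mul (hP _ hr)
  rw [lap_comp_norm hx hU h]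
  have e₁ : ‖x‖ ^ ((N : ℝ) - 1 + a) = ‖x‖ ^ (N : ℝ) / ‖x‖ * ‖x‖ ^ a := by
    rw [Real.rpow_add hr, Real.rpow_sub_one hr.ne']
  have e₂ : ‖x‖ ^ (1 - (N : ℝ)) = ‖x‖ / ‖x‖ ^ (N : ℝ) := by rw [Real.rpow_sub hr, Real.rpow_one]
  have hX := (Real.rpow_pos_of_pos hr (N : ℝ)).ne'
  rw [Real.rpow_sub_one hr.ne', e₁, e₂]
  field_simp
  ring

theorem exists_flux_of_radial {N : ℕ} (hN : 0 < N) {a : ℝ} {U F : ℝ → ℝ}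
    {u : EuclideanSpace ℝ (Fin N) → ℝ} (hu : ∀ x, u x = U ‖x‖) (hc : Continuous u)
    (hd : ContDiffOn ℝ 2 u (univ \ {0})) (hl : ∀ x ≠ 0, -lap u x = ‖x‖ ^ a * F ‖x‖) :
    ContinuousOn U (Ici 0) ∧ ∃ P : ℝ → ℝ, (∀ r > 0, HasDerivAt U (r ^ (1 - (N : ℝ)) * P r) r) ∧
      ∀ r > 0, HasDerivAt P (-(r ^ ((N : ℝ) - 1 + a) * F r)) r := by
  obtain ⟨e, he⟩ : ∃ e : EuclideanSpace ℝ (Fin N), ‖e‖ = 1 :=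
    ⟨EuclideanSpace.single ⟨0, hN⟩ 1, by simp⟩
  have he0 : e ≠ 0 := norm_ne_zero_iff.mp (by rw [he]; exact one_ne_zero)
  have hnorm : ∀ r : ℝ, 0 ≤ r → ‖r • e‖ = r := fun r hr => by
    rw [norm_smul, he, mul_one, Real.norm_of_nonneg hr]
  have hUu : ∀ r : ℝ, 0 ≤ r → U r = u (r • e) := fun r hr => by rw [hu, hnorm r hr]
  have hU2 : ContDiffOn ℝ 2 U (Ioi 0) := by
    refine (hd.comp (t := univ \ {0}) (s := Ioi 0) (f := fun r : ℝ => r • e)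
      (contDiff_id.smul contDiff_const).contDiffOn ?_).congr fun r hr => hUu r (le_of_lt hr)
    intro r hr
    exact ⟨mem_univ _, smul_ne_zero (ne_of_gt hr) he0⟩
  rw [show (2 : WithTop ℕ∞) = 1 + 1 by norm_num,
    contDiffOn_succ_iff_deriv_of_isOpen isOpen_Ioi] at hU2
  have hU1 : ∀ r > 0, HasDerivAt U (deriv U r) r := fun r hr =>
    ((hU2.1 r hr).differentiableAt (Ioi_mem_nhds hr)).hasDerivAt
  have hU1' : ∀ r > 0, HasDerivAt (deriv U) (deriv (deriv U) r) r := fun r hr =>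
    (((hU2.2.2.differentiableOn one_ne_zero) r hr).differentiableAt (Ioi_mem_nhds hr)).hasDerivAt
  refine ⟨(hc.comp (continuous_id.smul continuous_const)).continuousOn.congr
    fun r hr => hUu r hr, fun r => r ^ ((N : ℝ) - 1) * deriv U r, fun r hr => ?_, fun r hr => ?_⟩
  · refine (hU1 r hr).congr_deriv ?_
    rw [← mul_assoc, ← Real.rpow_add hr]
    simp
  · refine ((Real.hasDerivAt_rpow_const (p := (N : ℝ) - 1) (Or.inl hr.ne')).fun_mul
      (hU1' r hr)).congr_deriv ?_
    have hre : r • e ≠ 0 := smul_ne_zero hr.ne' he0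
    have h := hl (r • e) hre
    rw [show u = fun y => U ‖y‖ from funext hu,
      lap_comp_norm hre hU1 (by rw [hnorm r hr.le]; exact hU1' r hr), hnorm r hr.le] at h
    rw [Real.rpow_add hr, mul_assoc (r ^ ((N : ℝ) - 1)), ← h, Real.rpow_sub_one hr.ne' ((N : ℝ) - 1)]
    field_simp
    ring

/-- The solution `w` of `(r ^ (n - 1) * w')' = r ^ (n - 1 + a) * g r`, `w 0 = 0`, extended by
zero to the negative axis. -/
noncomputable def henonPotential (n a : ℝ) (g : ℝ → ℝ) (r : ℝ) : ℝ :=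
  (n - 2)⁻¹ * (max r 0 ^ (2 + a) * ∫ x in (0 : ℝ)..1, x ^ (1 + a) * (1 - x ^ (n - 2)) * g (r * x))

section HenonPotential

variable {n a : ℝ}

theorem henonPotential_weight_nonneg (hn : 2 < n) {x : ℝ} (hx : x ∈ Icc (0 : ℝ) 1) :
    0 ≤ x ^ (1 + a) * (1 - x ^ (n - 2)) :=
  mul_nonneg (Real.rpow_nonneg hx.1 _)
    (sub_nonneg.mpr (Real.rpow_le_one hx.1 hx.2 (by linarith)))

theorem intervalIntegrable_henonPotential_weight (hn : 2 < n) (ha : -2 < a) :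
    IntervalIntegrable (fun x : ℝ => x ^ (1 + a) * (1 - x ^ (n - 2))) volume 0 1 :=
  (intervalIntegral.intervalIntegrable_rpow' (by linarith)).mul_continuousOn
    (continuous_const.sub (Real.continuous_rpow_const (by linarith))).continuousOn

theorem intervalIntegrable_henonPotential (hn : 2 < n) (ha : -2 < a) {g : ℝ → ℝ}
    (hg : Continuous g) (r : ℝ) :
    IntervalIntegrable (fun x : ℝ => x ^ (1 + a) * (1 - x ^ (n - 2)) * g (r * x)) volume 0 1 :=
  (intervalIntegrable_henonPotential_weight hn ha).mul_continuousOn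
    (hg.comp (continuous_const.mul continuous_id)).continuousOn

theorem henonPotential_of_nonpos (ha : -2 < a) (g : ℝ → ℝ) {r : ℝ} (hr : r ≤ 0) :
    henonPotential n a g r = 0 := by
  rw [henonPotential, max_eq_right hr, Real.zero_rpow (by linarith), zero_mul, mul_zero]

theorem henonPotential_congr (ha : -2 < a) {g h : ℝ → ℝ} {r : ℝ}
    (hgh : ∀ t ∈ Icc 0 r, g t = h t) : henonPotential n a g r = henonPotential n a h r := by
  rcases le_total r 0 with hr | hr
  · rw [henonPotential_of_nonpos ha g hr, henonPotential_of_nonpos ha h hr]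
  · unfold henonPotential
    congr 2
    refine intervalIntegral.integral_congr fun x hx => ?_
    rw [uIcc_of_le zero_le_one] at hx
    simp only [hgh (r * x) ⟨mul_nonneg hr hx.1, mul_le_of_le_one_right hr hx.2⟩]

theorem henonPotential_mono (hn : 2 < n) (ha : -2 < a) {g h : ℝ → ℝ} (hg : Continuous g)
    (hh : Continuous h) {r : ℝ} (hgh : ∀ t ∈ Icc 0 r, g t ≤ h t) :
    henonPotential n a g r ≤ henonPotential n a h r := by
  rcases le_total r 0 with hr | hr
  · rw [henonPotential_of_nonpos ha g hr, henonPotential_of_nonpos ha h hr]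
  · unfold henonPotential
    refine mul_le_mul_of_nonneg_left (mul_le_mul_of_nonneg_left ?_
      (Real.rpow_nonneg (le_max_right _ _) _)) (inv_nonneg.mpr (by linarith))
    refine intervalIntegral.integral_mono_on zero_le_one
      (intervalIntegrable_henonPotential hn ha hg r)
      (intervalIntegrable_henonPotential hn ha hh r) fun x hx => ?_
    exact mul_le_mul_of_nonneg_left
      (hgh (r * x) ⟨mul_nonneg hr hx.1, mul_le_of_le_one_right hr hx.2⟩)
      (henonPotential_weight_nonneg hn hx)

theorem henonPotential_const (c r : ℝ) :
    henonPotential n a (fun _ => c) r = c * henonPotential n a (fun _ => 1) r := by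
  simp only [henonPotential, intervalIntegral.integral_mul_const]
  ring

theorem henonPotential_sub (hn : 2 < n) (ha : -2 < a) {g h : ℝ → ℝ} (hg : Continuous g)
    (hh : Continuous h) (r : ℝ) : henonPotential n a (fun t => g t - h t) r
      = henonPotential n a g r - henonPotential n a h r := by
  simp only [henonPotential, mul_sub (_ * _)]
  rw [intervalIntegral.integral_sub (intervalIntegrable_henonPotential hn ha hg r)
    (intervalIntegrable_henonPotential hn ha hh r)]
  ring

theorem henonPotential_one_pos (hn : 2 < n) (ha : -2 < a) :
    0 < henonPotential n a (fun _ => 1) 1 := by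
  unfold henonPotential
  refine mul_pos (inv_pos.mpr (by linarith)) (mul_pos (by positivity) ?_)
  refine intervalIntegral.intervalIntegral_pos_of_pos_on
    (intervalIntegrable_henonPotential hn ha continuous_const 1) (fun x hx => ?_) one_pos
  have h₁ := Real.rpow_pos_of_pos hx.1 (1 + a)
  have h₂ := Real.rpow_lt_one hx.1.le hx.2 (show 0 < n - 2 by linarith)
  have h₃ := sub_pos.mpr h₂
  positivity

theorem tendsto_henonPotential (hn : 2 < n) (ha : -2 < a) {ι : Type*} {l : Filter ι}
    [l.IsCountablyGenerated] {g : ι → ℝ → ℝ} {r : ι → ℝ} {g₀ : ℝ → ℝ} {r₀ M : ℝ}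
    (hg : ∀ i, Continuous (g i)) (hM : ∀ i t, |g i t| ≤ M)
    (hlim : ∀ x ∈ Icc (0 : ℝ) 1, Tendsto (fun i => g i (r i * x)) l (nhds (g₀ (r₀ * x))))
    (hr : Tendsto r l (nhds r₀)) :
    Tendsto (fun i => henonPotential n a (g i) (r i)) l (nhds (henonPotential n a g₀ r₀)) := by
  have hmax : Tendsto (fun i => max (r i) 0 ^ (2 + a)) l (nhds (max r₀ 0 ^ (2 + a))) :=
    ((Real.continuous_rpow_const (show 0 ≤ 2 + a by linarith)).comp
      (continuous_id.max continuous_const)).continuousAt.tendsto.comp hr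
  refine (hmax.mul ?_).const_mul _
  refine intervalIntegral.tendsto_integral_filter_of_dominated_convergence
    (fun x => x ^ (1 + a) * (1 - x ^ (n - 2)) * M) (Eventually.of_forall fun i => ?_)
    (Eventually.of_forall fun i => ?_)
    ((intervalIntegrable_henonPotential_weight hn ha).mul_const M) ?_
  · exact (intervalIntegrable_henonPotential hn ha (hg i) (r i)).def'.aestronglyMeasurable
  · refine Eventually.of_forall fun x hx => ?_
    rw [uIoc_of_le zero_le_one] at hx
    have hw := henonPotential_weight_nonneg (a := a) hn ⟨hx.1.le, hx.2⟩
    rw [Real.norm_eq_abs, abs_mul, abs_of_nonneg hw]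
    exact mul_le_mul_of_nonneg_left (hM i _) hw
  · refine Eventually.of_forall fun x hx => ?_
    rw [uIoc_of_le zero_le_one] at hx
    exact (hlim x ⟨hx.1.le, hx.2⟩).const_mul _

theorem continuous_henonPotential_param (hn : 2 < n) (ha : -2 < a) {X : Type*}
    [TopologicalSpace X] [FirstCountableTopology X] {g : X → ℝ → ℝ} {M : ℝ}
    (hg : Continuous (Function.uncurry g)) (hM : ∀ x t, |g x t| ≤ M) :
    Continuous (Function.uncurry fun x => henonPotential n a (g x)) := by
  rw [continuous_iff_continuousAt]
  rintro ⟨x₀, r₀⟩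
  refine tendsto_henonPotential (g := fun z : X × ℝ => g z.1) (r := fun z : X × ℝ => z.2) hn ha
    (fun z => hg.comp (continuous_const.prodMk continuous_id)) (fun z => hM z.1) (fun x _ => ?_)
    continuous_snd.continuousAt
  exact (hg.comp (continuous_fst.prodMk
    (continuous_snd.mul continuous_const))).continuousAt (x := (x₀, r₀))

theorem henonPotential_eq_of_pos (hn : 2 < n) (ha : -2 < a) {g : ℝ → ℝ} (hg : Continuous g)
    {r : ℝ} (hr : 0 < r) :
    henonPotential n a g r = (n - 2)⁻¹ * ((∫ t in (0 : ℝ)..r, t ^ (1 + a) * g t)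
      - r ^ (2 - n) * ∫ t in (0 : ℝ)..r, t ^ (n - 1 + a) * g t) := by
  have hint : ∀ c : ℝ, -1 < c → IntervalIntegrable (fun t : ℝ => t ^ c * g t) volume 0 r :=
    fun c hc => (intervalIntegral.intervalIntegrable_rpow' hc).mul_continuousOn hg.continuousOn
  unfold henonPotential
  congr 1
  rw [max_eq_left hr.le, ← intervalIntegral.integral_const_mul,
    ← intervalIntegral.integral_const_mul, ← intervalIntegral.integral_sub
      (hint _ (by linarith)) ((hint _ (by linarith)).const_mul _)]
  have hsub := intervalIntegral.mul_integral_comp_mul_left (a := 0) (b := 1) (c := r)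
    (f := fun t => t ^ (1 + a) * g t - r ^ (2 - n) * (t ^ (n - 1 + a) * g t))
  rw [mul_zero, mul_one] at hsub
  rw [← hsub, ← intervalIntegral.integral_const_mul]
  refine intervalIntegral.integral_congr_ae (Eventually.of_forall fun x hx => ?_)
  rw [uIoc_of_le zero_le_one] at hx
  have e₁ : r ^ (2 + a) = r * r ^ (1 + a) := by
    rw [← Real.rpow_one_add' hr.le (by linarith)]
    ring_nf
  have e₂ : r ^ (2 - n) * r ^ (n - 1 + a) = r ^ (1 + a) := by
    rw [← Real.rpow_add hr]
    ring_nf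
  have e₃ : x ^ (1 + a) * x ^ (n - 2) = x ^ (n - 1 + a) := by
    rw [← Real.rpow_add hx.1]
    ring_nf
  simp only [Real.mul_rpow hr.le hx.1.le]
  rw [e₁, ← e₂, ← e₃]
  ring

theorem hasDerivAt_integral_rpow_mul {c : ℝ} (hc : -1 < c) {g : ℝ → ℝ} (hg : Continuous g)
    {r : ℝ} (hr : 0 < r) :
    HasDerivAt (fun r => ∫ t in (0 : ℝ)..r, t ^ c * g t) (r ^ c * g r) r := by
  have hcont : ContinuousOn (fun t : ℝ => t ^ c * g t) (Ioi 0) :=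
    (continuousOn_id.rpow_const fun t ht => Or.inl (ne_of_gt ht)).mul hg.continuousOn
  exact intervalIntegral.integral_hasDerivAt_right
    ((intervalIntegral.intervalIntegrable_rpow' hc).mul_continuousOn hg.continuousOn)
    (hcont.stronglyMeasurableAtFilter isOpen_Ioi r hr) (hcont.continuousAt (Ioi_mem_nhds hr))

theorem hasDerivAt_henonPotential (hn : 2 < n) (ha : -2 < a) {g : ℝ → ℝ} (hg : Continuous g)
    {r : ℝ} (hr : 0 < r) : HasDerivAt (henonPotential n a g)
      (r ^ (1 - n) * ∫ t in (0 : ℝ)..r, t ^ (n - 1 + a) * g t) r := by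
  have h₁ := hasDerivAt_integral_rpow_mul (c := 1 + a) (by linarith) hg hr
  have h₂ := hasDerivAt_integral_rpow_mul (c := n - 1 + a) (by linarith) hg hr
  have h := (h₁.fun_sub ((Real.hasDerivAt_rpow_const (p := 2 - n)
    (Or.inl hr.ne')).fun_mul h₂)).const_mul (n - 2)⁻¹
  refine (h.congr_of_eventuallyEq ?_).congr_deriv ?_
  · filter_upwards [Ioi_mem_nhds hr] with s hs using henonPotential_eq_of_pos hn ha hg hs
  · have e₁ : r ^ (1 + a) = r ^ (2 - n) * r ^ (n - 1 + a) := by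
      rw [← Real.rpow_add hr]
      ring_nf
    have hn2 : n - 2 ≠ 0 := by linarith
    rw [e₁, show 2 - n - 1 = 1 - n by ring]
    field_simp
    ring

theorem integral_rpow_mul_nonneg {c : ℝ} {g : ℝ → ℝ} (hg : ∀ t, 0 ≤ g t) {r : ℝ} (hr : 0 ≤ r) :
    0 ≤ ∫ t in (0 : ℝ)..r, t ^ c * g t :=
  intervalIntegral.integral_nonneg hr fun t ht => mul_nonneg (Real.rpow_nonneg ht.1 _) (hg t)

theorem continuous_henonPotential (hn : 2 < n) (ha : -2 < a) {g : ℝ → ℝ} {M : ℝ}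
    (hg : Continuous g) (hM : ∀ t, |g t| ≤ M) : Continuous (henonPotential n a g) :=
  (continuous_henonPotential_param (X := Unit) (g := fun _ => g) hn ha
    (hg.comp continuous_snd) fun _ => hM).comp
    (f := fun r => ((), r)) (by fun_prop)

theorem monotone_henonPotential (hn : 2 < n) (ha : -2 < a) {g : ℝ → ℝ} {M : ℝ}
    (hg : Continuous g) (hg0 : ∀ t, 0 ≤ g t) (hM : ∀ t, g t ≤ M) :
    Monotone (henonPotential n a g) := by
  have hc := continuous_henonPotential hn ha hg fun t => (abs_of_nonneg (hg0 t)).trans_le (hM t)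
  refine MonotoneOn.Iic_union_Ici (a := 0) (fun r hr s hs _ => ?_) ?_
  · rw [henonPotential_of_nonpos ha g hr, henonPotential_of_nonpos ha g hs]
  · refine monotoneOn_of_deriv_nonneg (convex_Ici 0) hc.continuousOn (fun r hr => ?_)
      fun r hr => ?_ <;> rw [interior_Ici] at hr
    · exact (hasDerivAt_henonPotential hn ha hg hr).differentiableAt.differentiableWithinAt
    · rw [(hasDerivAt_henonPotential hn ha hg hr).deriv]
      exact mul_nonneg (Real.rpow_nonneg (le_of_lt hr) _)
        (integral_rpow_mul_nonneg hg0 (le_of_lt hr))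

theorem henonPotential_nonneg (hn : 2 < n) (ha : -2 < a) {g : ℝ → ℝ} (hg : Continuous g)
    (hg0 : ∀ t, 0 ≤ g t) (r : ℝ) : 0 ≤ henonPotential n a g r := by
  have h := henonPotential_mono (r := r) hn ha continuous_const hg fun t _ => hg0 t
  rwa [henonPotential_const, zero_mul] at h

theorem abs_henonPotential_sub_le (hn : 2 < n) (ha : -2 < a) {g : ℝ → ℝ} {M : ℝ}
    (hg : Continuous g) (hg0 : ∀ t, 0 ≤ g t) (hM : ∀ t, g t ≤ M) (r s : ℝ) :
    |henonPotential n a g r - henonPotential n a g s|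
      ≤ |henonPotential n a (fun _ => M) r - henonPotential n a (fun _ => M) s| := by
  have h₁ := monotone_henonPotential hn ha hg hg0 hM
  have h₂ := monotone_henonPotential (M := M) (g := fun t => M - g t) hn ha
    (continuous_const.sub hg) (fun t => sub_nonneg.mpr (hM t)) fun t => by linarith [hg0 t]
  have hsub := henonPotential_sub (n := n) (a := a) (g := fun _ => M) hn ha continuous_const hg
  rcases le_total r s with hrs | hrs
  · have h₃ := h₁ hrs
    have h₄ := h₂ hrs
    rw [hsub, hsub] at h₄
    rw [abs_of_nonpos (by linarith), abs_of_nonpos (by linarith)]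
    linarith
  · have h₃ := h₁ hrs
    have h₄ := h₂ hrs
    rw [hsub, hsub] at h₄
    rw [abs_of_nonneg (by linarith), abs_of_nonneg (by linarith)]
    linarith

end HenonPotential

/-- `U = c - henonPotential n a g` for a continuous source `g` with values in `[0, M]`. -/
def IsPotentialProfile (n a c M : ℝ) (U : ℝ → ℝ) : Prop :=
  ∃ g : ℝ → ℝ, Continuous g ∧ (∀ t, 0 ≤ g t) ∧ (∀ t, g t ≤ M) ∧
    U = fun r => c - henonPotential n a g r

namespace IsPotentialProfile

variable {n a c M : ℝ} {U : ℝ → ℝ}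

theorem continuous (h : IsPotentialProfile n a c M U) (hn : 2 < n) (ha : -2 < a) :
    Continuous U := by
  obtain ⟨g, hg, hg0, hgM, rfl⟩ := h
  exact continuous_const.sub
    (continuous_henonPotential hn ha hg fun t => (abs_of_nonneg (hg0 t)).trans_le (hgM t))

theorem antitone (h : IsPotentialProfile n a c M U) (hn : 2 < n) (ha : -2 < a) : Antitone U := by
  obtain ⟨g, hg, hg0, hgM, rfl⟩ := h
  exact fun r s hrs => sub_le_sub_left (monotone_henonPotential hn ha hg hg0 hgM hrs) c

theorem le (h : IsPotentialProfile n a c M U) (hn : 2 < n) (ha : -2 < a) (r : ℝ) : U r ≤ c := by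
  obtain ⟨g, hg, hg0, hgM, rfl⟩ := h
  exact sub_le_self c (henonPotential_nonneg hn ha hg hg0 r)

theorem abs_sub_le (h : IsPotentialProfile n a c M U) (hn : 2 < n) (ha : -2 < a) (r s : ℝ) :
    |U r - U s| ≤ |henonPotential n a (fun _ => M) r - henonPotential n a (fun _ => M) s| := by
  obtain ⟨g, hg, hg0, hgM, rfl⟩ := h
  rw [sub_sub_sub_cancel_left, abs_sub_comm]
  exact abs_henonPotential_sub_le hn ha hg hg0 hgM r s

theorem abs_le (h : IsPotentialProfile n a c M U) (hn : 2 < n) (ha : -2 < a) (r : ℝ) :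
    |U r| ≤ |c| + henonPotential n a (fun _ => M) r := by
  obtain ⟨g, hg, hg0, hgM, rfl⟩ := h
  refine (abs_sub _ _).trans (add_le_add_right ?_ _)
  rw [abs_of_nonneg (henonPotential_nonneg hn ha hg hg0 r)]
  exact henonPotential_mono hn ha hg continuous_const fun t _ => hgM t

end IsPotentialProfile

theorem exists_subseq_tendsto_of_modulus {u : ℕ → ℝ → ℝ} {ω C : ℝ → ℝ} (hω : Continuous ω)
    (hC : ∀ k r, |u k r| ≤ C r) (hu : ∀ k r s, |u k r - u k s| ≤ |ω r - ω s|) :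
    ∃ φ : ℕ → ℕ, StrictMono φ ∧ ∃ U : ℝ → ℝ, Continuous U ∧
      ∀ r, Tendsto (fun k => u (φ k) r) atTop (nhds (U r)) := by
  obtain ⟨L, -, φ, hφ, hL⟩ := (isCompact_univ_pi fun s : ℚ =>
    isCompact_Icc (a := -C s) (b := C s)).tendsto_subseq (x := fun k (s : ℚ) => u k s)
      fun k s _ => abs_le.mp (hC k s)
  rw [tendsto_pi_nhds] at hL
  have hcauchy : ∀ r, CauchySeq fun k => u (φ k) r := by
    intro r
    rw [Metric.cauchySeq_iff']
    intro ε hε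
    obtain ⟨s, hs⟩ : ∃ s : ℚ, |ω r - ω s| < ε / 3 := by
      obtain ⟨s, hs⟩ := Rat.denseRange_cast.exists_mem_open (s := {t : ℝ | |ω r - ω t| < ε / 3})
        (isOpen_lt (by fun_prop) continuous_const) ⟨r, by simpa using hε⟩
      exact ⟨s, hs⟩
    obtain ⟨m, hm⟩ := Metric.cauchySeq_iff'.mp (hL s).cauchySeq (ε / 3) (by positivity)
    refine ⟨m, fun k hk => ?_⟩
    have h₁ := (hu (φ k) r s).trans_lt hs
    have h₂ := (hu (φ m) r s).trans_lt hs
    have h₃ := hm k hk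
    simp only [Function.comp_apply, Real.dist_eq] at h₃ ⊢
    rw [abs_lt] at *
    constructor <;> linarith [h₁.1, h₁.2, h₂.1, h₂.2, h₃.1, h₃.2]
  choose U hU using fun r => cauchySeq_tendsto_of_complete (hcauchy r)
  refine ⟨φ, hφ, U, ?_, hU⟩
  have hUω : ∀ r s, |U r - U s| ≤ |ω r - ω s| := fun r s =>
    le_of_tendsto ((hU r).sub (hU s)).abs (Eventually.of_forall fun k => hu (φ k) r s)
  rw [continuous_iff_continuousAt]
  intro r
  have h : Tendsto (fun s => |ω s - ω r|) (nhds r) (nhds 0) := by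
    have h := ((hω.continuousAt (x := r)).tendsto.sub_const (ω r)).abs
    rwa [sub_self, abs_zero] at h
  rw [ContinuousAt, tendsto_iff_dist_tendsto_zero]
  exact squeeze_zero (fun s => dist_nonneg) (fun s => hUω s r) h

theorem continuous_max_zero_rpow {p : ℝ} (hp : 0 < p) : Continuous fun v : ℝ => max v 0 ^ p :=
  (Real.continuous_rpow_const hp.le).comp (continuous_id.max continuous_const)

theorem max_zero_rpow_le {p v c : ℝ} (hp : 0 < p) (hc : 0 ≤ c) (hv : v ≤ c) :
    max v 0 ^ p ≤ c ^ p :=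
  Real.rpow_le_rpow (le_max_right _ _) (max_le hv hc) hp.le

section Shooting

variable {n a b p q β₀ β₁ : ℝ}

theorem exists_delayed_solution (hn : 2 < n) (ha : -2 < a) (hb : -2 < b) (hp : 0 < p)
    (hq : 0 < q) (hβ₀ : 0 < β₀) (ε : ℝ) (k : ℕ) :
    ∃ U V : Icc β₀ β₁ → ℝ → ℝ,
      Continuous (Function.uncurry U) ∧ Continuous (Function.uncurry V) ∧
      (∀ β, IsPotentialProfile n a 1 (β₁ ^ p) (U β)) ∧
      (∀ β : Icc β₀ β₁, IsPotentialProfile n b β 1 (V β)) ∧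
      ∀ β : Icc β₀ β₁, ∀ r ≤ k * ε,
        U β r = 1 - henonPotential n a (fun t => max (V β (t - ε)) 0 ^ p) r ∧
        V β r = β - henonPotential n b (fun t => max (U β (t - ε)) 0 ^ q) r := by
  induction k with
  | zero =>
    refine ⟨fun _ _ => 1, fun β _ => β, continuous_const, continuous_subtype_val.comp continuous_fst,
      fun β => ?_, fun β => ?_, fun β r hr => ?_⟩
    · have hβ₁ : 0 ≤ β₁ := hβ₀.le.trans (β.2.1.trans β.2.2)
      exact ⟨fun _ => 0, continuous_const, fun _ => le_rfl, fun _ => by positivity,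
        funext fun r => by rw [henonPotential_const, zero_mul, sub_zero]⟩
    · exact ⟨fun _ => 0, continuous_const, fun _ => le_rfl, fun _ => zero_le_one,
        funext fun r => by rw [henonPotential_const, zero_mul, sub_zero]⟩
    · rw [Nat.cast_zero, zero_mul] at hr
      rw [henonPotential_of_nonpos ha _ hr, henonPotential_of_nonpos hb _ hr, sub_zero, sub_zero]
      exact ⟨rfl, rfl⟩
  | succ k ih =>
    obtain ⟨U, V, hUc, hVc, hU, hV, hUV⟩ := ih
    have hdelay : Continuous fun z : Icc β₀ β₁ × ℝ => (z.1, z.2 - ε) := by fun_prop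
    have hfc : Continuous (Function.uncurry fun (β : Icc β₀ β₁) t => max (V β (t - ε)) 0 ^ p) :=
      (continuous_max_zero_rpow hp).comp (hVc.comp hdelay)
    have hgc : Continuous (Function.uncurry fun (β : Icc β₀ β₁) t => max (U β (t - ε)) 0 ^ q) :=
      (continuous_max_zero_rpow hq).comp (hUc.comp hdelay)
    have hf0 : ∀ (β : Icc β₀ β₁) (t : ℝ), 0 ≤ max (V β (t - ε)) 0 ^ p := fun β t =>
      Real.rpow_nonneg (le_max_right _ _) _
    have hg0 : ∀ (β : Icc β₀ β₁) (t : ℝ), 0 ≤ max (U β (t - ε)) 0 ^ q := fun β t =>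
      Real.rpow_nonneg (le_max_right _ _) _
    have hfM : ∀ (β : Icc β₀ β₁) (t : ℝ), max (V β (t - ε)) 0 ^ p ≤ β₁ ^ p := fun β t =>
      max_zero_rpow_le hp (hβ₀.le.trans (β.2.1.trans β.2.2)) (((hV β).le hn hb _).trans β.2.2)
    have hgM : ∀ (β : Icc β₀ β₁) (t : ℝ), max (U β (t - ε)) 0 ^ q ≤ 1 := fun β t =>
      (max_zero_rpow_le hq zero_le_one ((hU β).le hn ha _)).trans_eq (Real.one_rpow q)
    refine ⟨fun β r => 1 - henonPotential n a (fun t => max (V β (t - ε)) 0 ^ p) r,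
      fun β r => β - henonPotential n b (fun t => max (U β (t - ε)) 0 ^ q) r,
      continuous_const.sub (continuous_henonPotential_param hn ha hfc
        fun β t => (abs_of_nonneg (hf0 β t)).trans_le (hfM β t)),
      (continuous_subtype_val.comp continuous_fst).sub (continuous_henonPotential_param hn hb hgc
        fun β t => (abs_of_nonneg (hg0 β t)).trans_le (hgM β t)),
      fun β => ⟨_, hfc.comp (Continuous.prodMk_right β), hf0 β, hfM β, rfl⟩,
      fun β => ⟨_, hgc.comp (Continuous.prodMk_right β), hg0 β, hgM β, rfl⟩, fun β r hr => ?_⟩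
    have hle : ∀ t ∈ Icc 0 r, t - ε ≤ k * ε := fun t ht => by
      push_cast at hr
      linarith [ht.2]
    constructor
    · exact congrArg (1 - ·) (henonPotential_congr ha fun t ht =>
        congrArg (fun v => max v 0 ^ p) (hUV β _ (hle t ht)).2)
    · exact congrArg ((β : ℝ) - ·) (henonPotential_congr hb fun t ht =>
        congrArg (fun v => max v 0 ^ q) (hUV β _ (hle t ht)).1)

theorem exists_balanced_delayed_solution (hn : 2 < n) (ha : -2 < a) (hb : -2 < b) (hp : 0 < p)
    (hq : 0 < q) (hβ₀ : 0 < β₀) (hβ : β₀ ≤ β₁)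
    (hsmall : β₀ ^ p * henonPotential n a (fun _ => 1) 1 ≤ 1 / 2)
    (hsmall' : β₀ < (1 / 2) ^ q * henonPotential n b (fun _ => 1) 1)
    (hlarge : henonPotential n b (fun _ => 1) 1 ≤ β₁ / 2)
    (hlarge' : 1 < (β₁ / 2) ^ p * henonPotential n a (fun _ => 1) 1)
    {ε : ℝ} (hε : 0 < ε) {k : ℕ} (hk : 1 ≤ k * ε) :
    ∃ β ∈ Icc β₀ β₁, ∃ U V : ℝ → ℝ,
      IsPotentialProfile n a 1 (β₁ ^ p) U ∧ IsPotentialProfile n b β 1 V ∧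
      (∀ r ≤ k * ε, U r = 1 - henonPotential n a (fun t => max (V (t - ε)) 0 ^ p) r ∧
        V r = β - henonPotential n b (fun t => max (U (t - ε)) 0 ^ q) r) ∧
      ∀ r, ¬(U r < 0 ∧ 0 < V r) ∧ ¬(V r < 0 ∧ 0 < U r) := by
  obtain ⟨U, V, hUc, hVc, hU, hV, hUV⟩ :=
    exists_delayed_solution (β₁ := β₁) hn ha hb hp hq hβ₀ ε k
  by_contra! hcon
  have hUr : ∀ r, Continuous fun β => U β r := fun r => hUc.comp (Continuous.prodMk_left r)
  have hVr : ∀ r, Continuous fun β => V β r := fun r => hVc.comp (Continuous.prodMk_left r)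
  have hopenA : IsOpen {β : Icc β₀ β₁ | ∃ r, U β r < 0 ∧ 0 < V β r} := by
    simp only [Set.ofPred_exists]
    exact isOpen_iUnion fun r =>
      (isOpen_lt (hUr r) continuous_const).inter (isOpen_lt continuous_const (hVr r))
  have hopenB : IsOpen {β : Icc β₀ β₁ | ∃ r, V β r < 0 ∧ 0 < U β r} := by
    simp only [Set.ofPred_exists]
    exact isOpen_iUnion fun r =>
      (isOpen_lt (hVr r) continuous_const).inter (isOpen_lt continuous_const (hUr r))
  have hcover : (univ : Set (Icc β₀ β₁)) ⊆ {β | ∃ r, U β r < 0 ∧ 0 < V β r} ∪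
      {β | ∃ r, V β r < 0 ∧ 0 < U β r} := by
    intro β _
    obtain ⟨r, hr⟩ := hcon β β.2 (U β) (V β) (hU β) (hV β) (hUV β)
    by_cases h : U β r < 0 ∧ 0 < V β r
    · exact Or.inl ⟨r, h⟩
    · refine Or.inr ⟨r, hr fun h₁ => ?_⟩
      exact not_lt.mp fun h₂ => h ⟨h₁, h₂⟩
  have hdelay : ∀ t ∈ Icc (0 : ℝ) 1, t - ε ≤ 1 := fun t ht => by linarith [ht.2]
  have hfc : ∀ β : Icc β₀ β₁, Continuous fun t => max (V β (t - ε)) 0 ^ p := fun β =>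
    (continuous_max_zero_rpow hp).comp (((hV β).continuous hn hb).comp
      (continuous_id.sub continuous_const))
  have hgc : ∀ β : Icc β₀ β₁, Continuous fun t => max (U β (t - ε)) 0 ^ q := fun β =>
    (continuous_max_zero_rpow hq).comp (((hU β).continuous hn ha).comp
      (continuous_id.sub continuous_const))
  have hβ₁ : 0 < β₁ := hβ₀.trans_le hβ
  have hmemB : (⟨β₀, le_rfl, hβ⟩ : Icc β₀ β₁) ∈ {β : Icc β₀ β₁ | ∃ r, V β r < 0 ∧ 0 < U β r} := by
    generalize hz : (⟨β₀, le_rfl, hβ⟩ : Icc β₀ β₁) = z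
    have hzβ : (z : ℝ) = β₀ := by rw [← hz]
    have hU1 : 1 / 2 ≤ U z 1 := by
      have h := henonPotential_mono (r := 1) hn ha (hfc z) continuous_const fun t _ =>
        max_zero_rpow_le hp hβ₀.le (((hV z).le hn hb _).trans_eq hzβ)
      rw [henonPotential_const] at h
      rw [(hUV z 1 hk).1]
      linarith
    refine ⟨1, ?_, by linarith⟩
    have h := henonPotential_mono (r := 1) (g := fun _ => (1 / 2 : ℝ) ^ q) hn hb continuous_const
      (hgc z) fun t ht => Real.rpow_le_rpow (by norm_num)
        ((hU1.trans ((hU z).antitone hn ha (hdelay t ht))).trans (le_max_left _ _)) hq.le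
    rw [henonPotential_const] at h
    rw [(hUV z 1 hk).2, hzβ]
    linarith
  have hmemA : (⟨β₁, hβ, le_rfl⟩ : Icc β₀ β₁) ∈ {β : Icc β₀ β₁ | ∃ r, U β r < 0 ∧ 0 < V β r} := by
    generalize hz : (⟨β₁, hβ, le_rfl⟩ : Icc β₀ β₁) = z
    have hzβ : (z : ℝ) = β₁ := by rw [← hz]
    have hV1 : β₁ / 2 ≤ V z 1 := by
      have h := henonPotential_mono (r := 1) hn hb (hgc z) continuous_const fun t _ =>
        max_zero_rpow_le hq zero_le_one ((hU z).le hn ha _)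
      rw [henonPotential_const, Real.one_rpow, one_mul] at h
      rw [(hUV z 1 hk).2, hzβ]
      linarith
    refine ⟨1, ?_, by linarith⟩
    have h := henonPotential_mono (r := 1) (g := fun _ => (β₁ / 2) ^ p) hn ha continuous_const
      (hfc z) fun t ht => Real.rpow_le_rpow (by positivity)
        ((hV1.trans ((hV z).antitone hn hb (hdelay t ht))).trans (le_max_left _ _)) hp.le
    rw [henonPotential_const] at h
    rw [(hUV z 1 hk).1]
    linarith
  have : PreconnectedSpace (Icc β₀ β₁) := Subtype.preconnectedSpace isPreconnected_Icc
  obtain ⟨β, -, ⟨r, hr⟩, s, hs⟩ := isPreconnected_univ _ _ hopenA hopenB hcover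
    ⟨_, mem_univ _, hmemA⟩ ⟨_, mem_univ _, hmemB⟩
  rcases le_total r s with hrs | hrs
  · exact absurd ((hU β).antitone hn ha hrs) (by linarith [hr.1, hs.2])
  · exact absurd ((hV β).antitone hn hb hrs) (by linarith [hr.2, hs.1])

end Shooting

theorem exists_flux_henonPotential {n a M : ℝ} (hn : 2 < n) (ha : -2 < a) {f : ℝ → ℝ}
    (hf : Continuous f) (hf0 : ∀ t, 0 ≤ f t) (hfM : ∀ t, f t ≤ M) (hpos : 0 < f 0) (c : ℝ) :
    ∃ P : ℝ → ℝ,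
      (∀ r > 0, HasDerivAt (fun r => c - henonPotential n a f r) (r ^ (1 - n) * P r) r) ∧
      (∀ r > 0, HasDerivAt P (-(r ^ (n - 1 + a) * f r)) r) ∧ (∀ r > 0, P r < 0) ∧
      Tendsto (fun r => r ^ (2 - n) * P r) (nhdsWithin 0 (Ioi 0)) (nhds 0) := by
  have hint : ∀ r : ℝ, IntervalIntegrable (fun t : ℝ => t ^ (n - 1 + a) * f t) volume 0 r :=
    fun r => (intervalIntegral.intervalIntegrable_rpow' (by linarith)).mul_continuousOn
      hf.continuousOn
  refine ⟨fun r => -∫ t in (0 : ℝ)..r, t ^ (n - 1 + a) * f t, fun r hr => ?_, fun r hr => ?_,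
    fun r hr => ?_, ?_⟩
  · rw [mul_neg]
    exact (hasDerivAt_henonPotential hn ha hf hr).const_sub c
  · exact (hasDerivAt_integral_rpow_mul (by linarith) hf hr).fun_neg
  · obtain ⟨δ, hδ, hδf⟩ := Metric.eventually_nhds_iff.mp
      ((hf.continuousAt (x := 0)).eventually (lt_mem_nhds hpos))
    have hs : 0 < min (δ / 2) r := by positivity
    have h₁ : 0 < ∫ t in (0 : ℝ)..min (δ / 2) r, t ^ (n - 1 + a) * f t := by
      refine intervalIntegral.intervalIntegral_pos_of_pos_on (hint _) (fun t ht => ?_) hs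
      refine mul_pos (Real.rpow_pos_of_pos ht.1 _) (hδf ?_)
      rw [Real.dist_eq, sub_zero, abs_of_pos ht.1]
      linarith [ht.2, min_le_left (δ / 2) r]
    have h₂ := intervalIntegral.integral_mono_interval (μ := volume) le_rfl hs.le
      (min_le_right (δ / 2) r)
      ((ae_restrict_iff' measurableSet_Ioc).mpr (Eventually.of_forall fun t ht =>
        mul_nonneg (Real.rpow_nonneg ht.1.le (n - 1 + a)) (hf0 t))) (hint r)
    exact neg_neg_of_pos (h₁.trans_le h₂)
  · have hlim : Tendsto (fun r : ℝ => M / (n + a) * r ^ (2 + a)) (nhdsWithin 0 (Ioi 0))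
        (nhds 0) := by
      have h := ((Real.continuous_rpow_const (show 0 ≤ 2 + a by linarith)).const_mul
        (M / (n + a))).tendsto 0
      rw [Real.zero_rpow (by linarith), mul_zero] at h
      exact h.mono_left nhdsWithin_le_nhds
    refine squeeze_zero_norm' ?_ hlim
    filter_upwards [self_mem_nhdsWithin] with r hr
    have hr0 : 0 < r := hr
    have h₁ : ∫ t in (0 : ℝ)..r, t ^ (n - 1 + a) * f t ≤ M * (r ^ (n + a) / (n + a)) := by
      have h := intervalIntegral.integral_mono_on (g := fun t => t ^ (n - 1 + a) * M) hr0.le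
        (hint r) ((intervalIntegral.intervalIntegrable_rpow' (by linarith)).mul_const M)
        fun t ht => mul_le_mul_of_nonneg_left (hfM t) (Real.rpow_nonneg ht.1 _)
      rw [intervalIntegral.integral_mul_const, integral_rpow (Or.inl (by linarith)),
        show n - 1 + a + 1 = n + a by ring, Real.zero_rpow (by linarith), sub_zero] at h
      linarith
    have h₂ : r ^ (2 + a) = r ^ (2 - n) * r ^ (n + a) := by
      rw [← Real.rpow_add hr0]
      ring_nf
    rw [Real.norm_eq_abs, abs_mul, abs_neg, abs_of_pos (Real.rpow_pos_of_pos hr0 _),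
      abs_of_nonneg (integral_rpow_mul_nonneg hf0 hr0.le), h₂]
    calc _ ≤ r ^ (2 - n) * (M * (r ^ (n + a) / (n + a))) :=
          mul_le_mul_of_nonneg_left h₁ (Real.rpow_nonneg hr0.le _)
      _ = _ := by ring

/-- In the critical and supercritical range the two components of a radial solution cannot
vanish for the first time at the same radius. -/
theorem not_simultaneous_zero {n a b p q : ℝ} {U V P Q : ℝ → ℝ} (hn : 2 < n) (ha : -2 < a)
    (hb : -2 < b) (hp : 0 < p) (hq : 0 < q)
    (hsup : (n + a) / (p + 1) + (n + b) / (q + 1) ≤ n - 2)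
    (hUc : Continuous U) (hVc : Continuous V)
    (hU : ∀ r > 0, HasDerivAt U (r ^ (1 - n) * P r) r)
    (hV : ∀ r > 0, HasDerivAt V (r ^ (1 - n) * Q r) r)
    (hP : ∀ r > 0, HasDerivAt P (-(r ^ (n - 1 + a) * max (V r) 0 ^ p)) r)
    (hQ : ∀ r > 0, HasDerivAt Q (-(r ^ (n - 1 + b) * max (U r) 0 ^ q)) r)
    (hPneg : ∀ r > 0, P r < 0) (hQneg : ∀ r > 0, Q r < 0)
    (hP0 : Tendsto (fun r => r ^ (2 - n) * P r) (nhdsWithin 0 (Ioi 0)) (nhds 0))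
    (hQ0 : Tendsto (fun r => r ^ (2 - n) * Q r) (nhdsWithin 0 (Ioi 0)) (nhds 0))
    {R : ℝ} (hR : 0 < R) (hpos : ∀ r ∈ Ioo 0 R, 0 < U r ∧ 0 < V r) :
    ¬(U R = 0 ∧ V R = 0) := by
  rintro ⟨hUR, hVR⟩
  obtain ⟨d, hd0, hd⟩ : ∃ d ≥ 0, (n + a) / (p + 1) + (n + b) / (q + 1) + 2 * d = n - 2 :=
    ⟨(n - 2 - ((n + a) / (p + 1) + (n + b) / (q + 1))) / 2, by linarith, by ring⟩
  set E := pohozaev n a b p q d U V P Q with hE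
  have hderiv : ∀ r ∈ Ioo 0 R, HasDerivAt E
      (-d * (r ^ (n + a - 1) * V r ^ (p + 1) + r ^ (n + b - 1) * U r ^ (q + 1))) r := by
    intro r hr
    obtain ⟨hUr, hVr⟩ := hpos r hr
    have hPr := hP r hr.1
    have hQr := hQ r hr.1
    rw [max_eq_left hVr.le] at hPr
    rw [max_eq_left hUr.le] at hQr
    exact hasDerivAt_pohozaev hp hq hr.1 hd hUr hVr (hU r hr.1) (hV r hr.1) hPr hQr
  have hpow : ∀ c : ℝ, ContinuousOn (fun r : ℝ => r ^ c) (Ioi 0) := fun c =>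
    continuousOn_id.rpow_const fun r hr => Or.inl (ne_of_gt hr)
  have hPc : ContinuousOn P (Ioi 0) := fun r hr => (hP r hr).continuousAt.continuousWithinAt
  have hQc : ContinuousOn Q (Ioi 0) := fun r hr => (hQ r hr).continuousAt.continuousWithinAt
  have hUq : Continuous fun r => U r ^ (q + 1) := hUc.rpow_const fun _ => Or.inr (by linarith)
  have hVp : Continuous fun r => V r ^ (p + 1) := hVc.rpow_const fun _ => Or.inr (by linarith)
  have hcont : ContinuousOn E (Ioi 0) :=
    ((((hpow _).mul (hPc.mul hQc)).add (((hpow _).mul hUq.continuousOn).div_const _)).add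
      (((hpow _).mul hVp.continuousOn).div_const _)).add
      (continuousOn_const.mul (hPc.mul hVc.continuousOn)) |>.add
      (continuousOn_const.mul (hQc.mul hUc.continuousOn))
  have hanti : AntitoneOn E (Ioc 0 R) := by
    refine antitoneOn_of_deriv_nonpos (convex_Ioc 0 R) (hcont.mono fun r hr => hr.1)
      (fun r hr => ?_) fun r hr => ?_ <;> rw [interior_Ioc] at hr
    · exact (hderiv r hr).differentiableAt.differentiableWithinAt
    · rw [(hderiv r hr).deriv]
      obtain ⟨hUr, hVr⟩ := hpos r hr
      have hr0 := hr.1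
      have : 0 ≤ d * (r ^ (n + a - 1) * V r ^ (p + 1) + r ^ (n + b - 1) * U r ^ (q + 1)) := by
        positivity
      linarith
  have hpow0 : ∀ c : ℝ, 0 < c → Tendsto (fun r : ℝ => r ^ c) (nhdsWithin 0 (Ioi 0)) (nhds 0) := by
    intro c hc
    have h := (Real.continuous_rpow_const hc.le).tendsto 0
    rw [Real.zero_rpow hc.ne'] at h
    exact h.mono_left nhdsWithin_le_nhds
  have hflux : ∀ F : ℝ → ℝ, Tendsto (fun r => r ^ (2 - n) * F r) (nhdsWithin 0 (Ioi 0)) (nhds 0) →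
      Tendsto F (nhdsWithin 0 (Ioi 0)) (nhds 0) := by
    intro F hF
    have h := (hpow0 (n - 2) (by linarith)).mul hF
    rw [mul_zero] at h
    refine h.congr' ?_
    filter_upwards [self_mem_nhdsWithin] with r hr
    rw [← mul_assoc, ← Real.rpow_add hr]
    simp
  have hlim : Tendsto E (nhdsWithin 0 (Ioi 0)) (nhds 0) := by
    have hUt := (hUc.tendsto 0).mono_left (nhdsWithin_le_nhds (s := Ioi 0))
    have hVt := (hVc.tendsto 0).mono_left (nhdsWithin_le_nhds (s := Ioi 0))
    have hUqt := (hUq.tendsto 0).mono_left (nhdsWithin_le_nhds (s := Ioi 0))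
    have hVpt := (hVp.tendsto 0).mono_left (nhdsWithin_le_nhds (s := Ioi 0))
    have h := ((((hP0.mul (hflux Q hQ0)).add
      (((hpow0 (n + b) (by linarith)).mul hUqt).div_const (q + 1))).add
      (((hpow0 (n + a) (by linarith)).mul hVpt).div_const (p + 1))).add
      (((hflux P hP0).mul hVt).const_mul ((n + a) / (p + 1) + d))).add
      (((hflux Q hQ0).mul hUt).const_mul ((n + b) / (q + 1) + d))
    simp only [zero_mul, zero_div, mul_zero, add_zero] at h
    refine h.congr fun r => ?_
    rw [hE, pohozaev, mul_assoc]
  have hER : E R ≤ 0 := by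
    refine ge_of_tendsto hlim ?_
    filter_upwards [Ioo_mem_nhdsGT hR] with r hr using
      hanti ⟨hr.1, hr.2.le⟩ ⟨hR, le_rfl⟩ hr.2.le
  have hERpos : 0 < E R := by
    rw [hE, pohozaev, hUR, hVR, Real.zero_rpow (by linarith), Real.zero_rpow (by linarith)]
    simp only [mul_zero, zero_div, add_zero]
    exact mul_pos (Real.rpow_pos_of_pos hR _) (mul_pos_of_neg_of_neg (hPneg R hR) (hQneg R hR))
  exact absurd hERpos hER.not_gt

theorem eq_zero_of_balanced {U V : ℝ → ℝ} (hVc : Continuous V) (hU : StrictAntiOn U (Ioi 0))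
    (hbal : ∀ r, ¬(U r < 0 ∧ 0 < V r)) {R : ℝ} (hR : 0 < R) (hUR : U R = 0) (hVR : 0 ≤ V R) :
    V R = 0 := by
  by_contra hne
  have hpos : 0 < V R := lt_of_le_of_ne hVR (Ne.symm hne)
  obtain ⟨r, hVr, hr⟩ := ((hVc.continuousAt.eventually (lt_mem_nhds hpos)).filter_mono
    nhdsWithin_le_nhds |>.and (self_mem_nhdsWithin (a := R) (s := Ioi R))).exists
  exact hbal r ⟨(hU hR (hR.trans hr) hr).trans_eq hUR, hVr⟩

theorem pos_of_balanced {U V : ℝ → ℝ} (hUc : Continuous U) (hVc : Continuous V)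
    (hU : StrictAntiOn U (Ioi 0)) (hV : StrictAntiOn V (Ioi 0)) (hU0 : 0 < U 0) (hV0 : 0 < V 0)
    (hbal : ∀ r, ¬(U r < 0 ∧ 0 < V r) ∧ ¬(V r < 0 ∧ 0 < U r))
    (hzero : ∀ R > 0, (∀ r ∈ Ioo 0 R, 0 < U r ∧ 0 < V r) → ¬(U R = 0 ∧ V R = 0))
    {r : ℝ} (hr : 0 ≤ r) : 0 < U r ∧ 0 < V r := by
  rw [← lt_min_iff]
  by_contra! hle
  obtain ⟨R, hR, hmin⟩ := intermediate_value_Icc' hr (hUc.min hVc).continuousOn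
    ⟨hle, (lt_min hU0 hV0).le⟩
  have hR0 : 0 < R := by
    rcases hR.1.eq_or_lt with h | h
    · rw [← h] at hmin
      exact absurd hmin (lt_min hU0 hV0).ne'
    · exact h
  have h : U R = 0 ∧ V R = 0 := by
    rcases min_choice (U R) (V R) with h | h
    · have hUR := h.symm.trans hmin
      exact ⟨hUR, eq_zero_of_balanced hVc hU (fun r => (hbal r).1) hR0 hUR
        (hmin.symm.trans_le (min_le_right _ _))⟩
    · have hVR := h.symm.trans hmin
      exact ⟨eq_zero_of_balanced hUc hV (fun r => (hbal r).2) hR0 hVR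
        (hmin.symm.trans_le (min_le_left _ _)), hVR⟩
  refine hzero R hR0 (fun s hs => ⟨?_, ?_⟩) h
  · exact h.1.symm.trans_lt (hU hs.1 hR0 hs.2)
  · exact h.2.symm.trans_lt (hV hs.1 hR0 hs.2)

theorem tendsto_apply_of_modulus {u : ℕ → ℝ → ℝ} {ω : ℝ → ℝ} {s : ℕ → ℝ} {t y : ℝ}
    (hω : Continuous ω) (hu : ∀ k r s, |u k r - u k s| ≤ |ω r - ω s|)
    (hs : Tendsto s atTop (nhds t)) (ht : Tendsto (fun k => u k t) atTop (nhds y)) :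
    Tendsto (fun k => u k (s k)) atTop (nhds y) := by
  have h₁ : Tendsto (fun k => |ω (s k) - ω t|) atTop (nhds 0) := by
    have h := (((hω.tendsto t).comp hs).sub_const (ω t)).abs
    rwa [sub_self, abs_zero] at h
  have h₂ := (squeeze_zero_norm (fun k => hu k (s k) t) h₁).add ht
  simpa using h₂

theorem exists_shooting_bounds {p q κ μ : ℝ} (hp : 0 < p) (hκ : 0 < κ) (hμ : 0 < μ) :
    ∃ β₀ β₁ : ℝ, 0 < β₀ ∧ β₀ ≤ β₁ ∧ β₀ ^ p * κ ≤ 1 / 2 ∧ β₀ < (1 / 2) ^ q * μ ∧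
      μ ≤ β₁ / 2 ∧ 1 < (β₁ / 2) ^ p * κ := by
  have h₀ : ∀ᶠ β : ℝ in nhdsWithin 0 (Ioi 0), β ^ p * κ < 1 / 2 := by
    refine (((Real.continuous_rpow_const hp.le).mul_const κ).tendsto 0).mono_left
      nhdsWithin_le_nhds |>.eventually_lt_const ?_
    rw [Real.zero_rpow hp.ne', zero_mul]
    norm_num
  obtain ⟨β₀, hβ₀, hβ₀μ⟩ := (h₀.and (Ioo_mem_nhdsGT (show 0 < (1 / 2) ^ q * μ by positivity))).exists
  have h₁ : Tendsto (fun β : ℝ => (β / 2) ^ p * κ) atTop atTop :=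
    ((tendsto_rpow_atTop hp).comp (tendsto_id.atTop_div_const two_pos)).atTop_mul_const hκ
  obtain ⟨β₁, hβ₁, h2μ, hβ⟩ := ((h₁.eventually_gt_atTop 1).and
    ((eventually_ge_atTop (2 * μ)).and (eventually_ge_atTop β₀))).exists
  exact ⟨β₀, β₁, hβ₀μ.1, hβ, hβ₀.le, hβ₀μ.2, by linarith, hβ₁⟩

theorem exists_balanced_solution {n a b p q : ℝ} (hn : 2 < n) (ha : -2 < a) (hb : -2 < b)
    (hp : 0 < p) (hq : 0 < q) :
    ∃ β > 0, ∃ U V : ℝ → ℝ, Continuous U ∧ Continuous V ∧ (∀ r, U r ≤ 1) ∧ (∀ r, V r ≤ β) ∧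
      (∀ r, U r = 1 - henonPotential n a (fun t => max (V t) 0 ^ p) r) ∧
      (∀ r, V r = β - henonPotential n b (fun t => max (U t) 0 ^ q) r) ∧
      ∀ r, ¬(U r < 0 ∧ 0 < V r) ∧ ¬(V r < 0 ∧ 0 < U r) := by
  obtain ⟨β₀, β₁, hβ₀, hβ₀₁, hsmall, hsmall', hlarge, hlarge'⟩ :=
    exists_shooting_bounds (q := q) hp (henonPotential_one_pos hn ha) (henonPotential_one_pos hn hb)
  have hβ₁ : 0 ≤ β₁ := hβ₀.le.trans hβ₀₁
  have hstep : ∀ k : ℕ, (((k + 1) ^ 2 : ℕ) : ℝ) * (1 / ((k : ℝ) + 1)) = k + 1 := fun k => by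
    push_cast
    field_simp
  have happrox := fun k : ℕ => exists_balanced_delayed_solution hn ha hb hp hq hβ₀ hβ₀₁ hsmall
    hsmall' hlarge hlarge' (ε := 1 / ((k : ℝ) + 1)) (by positivity) (k := (k + 1) ^ 2)
    (by rw [hstep]; linarith [Nat.cast_nonneg (α := ℝ) k])
  simp only [hstep] at happrox
  choose β hβ U V hU hV hUV hbal using happrox
  have hcont : ∀ c M : ℝ, -2 < c → Continuous (henonPotential n c fun _ => M) := fun c M hc =>
    continuous_henonPotential hn hc continuous_const fun _ => le_rfl
  have hUmod := fun k r s => (hU k).abs_sub_le hn ha r s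
  have hVmod := fun k r s => (hV k).abs_sub_le hn hb r s
  obtain ⟨φ₁, hφ₁, U₀, hU₀c, hU₀⟩ := exists_subseq_tendsto_of_modulus (hcont a (β₁ ^ p) ha)
    (fun k r => (hU k).abs_le hn ha r) hUmod
  obtain ⟨φ₂, hφ₂, V₀, hV₀c, hV₀⟩ := exists_subseq_tendsto_of_modulus (u := fun k => V (φ₁ k))
    (C := fun r => β₁ + henonPotential n b (fun _ => 1) r) (hcont b 1 hb)
    (fun k r => ((hV (φ₁ k)).abs_le hn hb r).trans (by
      rw [abs_of_pos (hβ₀.trans_le (hβ _).1)]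
      linarith [(hβ (φ₁ k)).2])) fun k => hVmod (φ₁ k)
  obtain ⟨β', hβ', φ₃, hφ₃, hβlim⟩ := isCompact_Icc.tendsto_subseq fun k => hβ (φ₁ (φ₂ k))
  obtain ⟨φ, hφ, hφeq⟩ : ∃ φ : ℕ → ℕ, Tendsto φ atTop atTop ∧ ∀ k, φ k = φ₁ (φ₂ (φ₃ k)) :=
    ⟨_, (hφ₁.comp (hφ₂.comp hφ₃)).tendsto_atTop, fun _ => rfl⟩
  have hUt : ∀ r, Tendsto (fun k => U (φ k) r) atTop (nhds (U₀ r)) := fun r => by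
    simp only [hφeq]
    exact (hU₀ r).comp (hφ₂.comp hφ₃).tendsto_atTop
  have hVt : ∀ r, Tendsto (fun k => V (φ k) r) atTop (nhds (V₀ r)) := fun r => by
    simp only [hφeq]
    exact (hV₀ r).comp hφ₃.tendsto_atTop
  have hβt : Tendsto (fun k => β (φ k)) atTop (nhds β') := by
    simp only [hφeq]
    exact hβlim
  have hdelay : ∀ t : ℝ, Tendsto (fun k => t - 1 / ((φ k : ℝ) + 1)) atTop (nhds t) := fun t => by
    simpa using (tendsto_one_div_add_atTop_nhds_zero_nat.comp hφ).const_sub t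
  have hreach : ∀ r : ℝ, ∀ᶠ k in atTop, r ≤ (φ k : ℝ) + 1 := fun r => by
    filter_upwards [(tendsto_natCast_atTop_atTop.comp hφ).eventually_ge_atTop r] with k hk
    exact hk.trans (le_add_of_nonneg_right zero_le_one)
  refine ⟨β', hβ₀.trans_le hβ'.1, U₀, V₀, hU₀c, hV₀c,
    fun r => le_of_tendsto' (hUt r) fun k => (hU _).le hn ha r,
    fun r => le_of_tendsto_of_tendsto' (hVt r) hβt fun k => (hV _).le hn hb r,
    fun r => ?_, fun r => ?_, fun r => ⟨fun h => ?_, fun h => ?_⟩⟩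
  · have hlim := tendsto_henonPotential (M := β₁ ^ p) (r := fun _ => r) (r₀ := r) hn ha
      (g := fun k t => max (V (φ k) (t - 1 / ((φ k : ℝ) + 1))) 0 ^ p)
      (g₀ := fun t => max (V₀ t) 0 ^ p)
      (fun k => (continuous_max_zero_rpow hp).comp
        (((hV _).continuous hn hb).comp (continuous_id.sub continuous_const)))
      (fun k t => (abs_of_nonneg (Real.rpow_nonneg (le_max_right _ _) _)).trans_le
        (max_zero_rpow_le hp hβ₁ (((hV _).le hn hb _).trans (hβ _).2)))
      (fun x _ => ((continuous_max_zero_rpow hp).tendsto _).comp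
        (tendsto_apply_of_modulus (u := fun k => V (φ k)) (hcont b 1 hb) (fun k => hVmod (φ k))
          (hdelay (r * x)) (hVt (r * x)))) tendsto_const_nhds
    refine tendsto_nhds_unique_of_eventuallyEq (hUt r) (hlim.const_sub 1) ?_
    filter_upwards [hreach r] with k hk using (hUV (φ k) r hk).1
  · have hlim := tendsto_henonPotential (M := 1) (r := fun _ => r) (r₀ := r) hn hb
      (g := fun k t => max (U (φ k) (t - 1 / ((φ k : ℝ) + 1))) 0 ^ q)
      (g₀ := fun t => max (U₀ t) 0 ^ q)
      (fun k => (continuous_max_zero_rpow hq).comp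
        (((hU _).continuous hn ha).comp (continuous_id.sub continuous_const)))
      (fun k t => (abs_of_nonneg (Real.rpow_nonneg (le_max_right _ _) _)).trans_le
        ((max_zero_rpow_le hq zero_le_one ((hU _).le hn ha _)).trans_eq (Real.one_rpow q)))
      (fun x _ => ((continuous_max_zero_rpow hq).tendsto _).comp
        (tendsto_apply_of_modulus (u := fun k => U (φ k)) (hcont a (β₁ ^ p) ha)
          (fun k => hUmod (φ k)) (hdelay (r * x)) (hUt (r * x)))) tendsto_const_nhds
    refine tendsto_nhds_unique_of_eventuallyEq (hVt r) (hβt.sub hlim) ?_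
    filter_upwards [hreach r] with k hk using (hUV (φ k) r hk).2
  · obtain ⟨k, hk⟩ := (((hUt r).eventually_lt_const h.1).and
      ((hVt r).eventually_const_lt h.2)).exists
    exact (hbal (φ k) r).1 hk
  · obtain ⟨k, hk⟩ := (((hVt r).eventually_lt_const h.1).and
      ((hUt r).eventually_const_lt h.2)).exists
    exact (hbal (φ k) r).2 hk

theorem exists_positive_entire_solution {n a b p q : ℝ} (hn : 2 < n) (ha : -2 < a) (hb : -2 < b)
    (hp : 0 < p) (hq : 0 < q) (hsup : (n + a) / (p + 1) + (n + b) / (q + 1) ≤ n - 2) :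
    ∃ U V P Q : ℝ → ℝ, Continuous U ∧ Continuous V ∧ (∀ r ≥ 0, 0 < U r) ∧ (∀ r ≥ 0, 0 < V r) ∧
      (∀ r > 0, HasDerivAt U (r ^ (1 - n) * P r) r) ∧
      (∀ r > 0, HasDerivAt V (r ^ (1 - n) * Q r) r) ∧
      (∀ r > 0, HasDerivAt P (-(r ^ (n - 1 + a) * V r ^ p)) r) ∧
      ∀ r > 0, HasDerivAt Q (-(r ^ (n - 1 + b) * U r ^ q)) r := by
  obtain ⟨β, hβ, U, V, hUc, hVc, hU1, hVβ, hUeq, hVeq, hbal⟩ :=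
    exists_balanced_solution hn ha hb hp hq
  have hU0 : U 0 = 1 := by rw [hUeq, henonPotential_of_nonpos ha _ le_rfl, sub_zero]
  have hV0 : V 0 = β := by rw [hVeq, henonPotential_of_nonpos hb _ le_rfl, sub_zero]
  obtain ⟨P, hU, hP, hPneg, hP0⟩ := exists_flux_henonPotential hn ha
    ((continuous_max_zero_rpow hp).comp hVc) (fun t => Real.rpow_nonneg (le_max_right _ _) _)
    (fun t => max_zero_rpow_le hp hβ.le (hVβ t))
    (Real.rpow_pos_of_pos (lt_max_of_lt_left (hβ.trans_eq hV0.symm)) _) 1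
  obtain ⟨Q, hV, hQ, hQneg, hQ0⟩ := exists_flux_henonPotential hn hb
    ((continuous_max_zero_rpow hq).comp hUc) (fun t => Real.rpow_nonneg (le_max_right _ _) _)
    (fun t => max_zero_rpow_le hq zero_le_one (hU1 t))
    (Real.rpow_pos_of_pos (lt_max_of_lt_left (one_pos.trans_eq hU0.symm)) _) β
  have hU' : ∀ r > 0, HasDerivAt U (r ^ (1 - n) * P r) r := fun r hr =>
    (hU r hr).congr_of_eventuallyEq (Eventually.of_forall hUeq)
  have hV' : ∀ r > 0, HasDerivAt V (r ^ (1 - n) * Q r) r := fun r hr =>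
    (hV r hr).congr_of_eventuallyEq (Eventually.of_forall hVeq)
  have hpos : ∀ r ≥ 0, 0 < U r ∧ 0 < V r := fun r hr =>
    pos_of_balanced hUc hVc (strictAntiOn_of_flux_neg hU' hPneg)
      (strictAntiOn_of_flux_neg hV' hQneg) (one_pos.trans_eq hU0.symm) (hβ.trans_eq hV0.symm) hbal
      (fun R hR h => not_simultaneous_zero hn ha hb hp hq hsup hUc hVc hU' hV' hP hQ hPneg hQneg
        hP0 hQ0 hR h) hr
  refine ⟨U, V, P, Q, hUc, hVc, fun r hr => (hpos r hr).1, fun r hr => (hpos r hr).2, hU', hV',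
    fun r hr => ?_, fun r hr => ?_⟩
  · have h := hP r hr
    simp only [Function.comp_apply, max_eq_left (hpos r hr.le).2.le] at h
    exact h
  · have h := hQ r hr
    simp only [Function.comp_apply, max_eq_left (hpos r hr.le).1.le] at h
    exact h

theorem contDiffOn_comp_norm {E : Type*} [NormedAddCommGroup E] [InnerProductSpace ℝ E]
    {U : ℝ → ℝ} (hU : ContDiffOn ℝ 2 U (Ioi 0)) :
    ContDiffOn ℝ 2 (fun x : E => U ‖x‖) (univ \ {0}) :=
  hU.comp (fun _ hx => (contDiffAt_norm ℝ hx.2).contDiffWithinAt)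
    fun _ hx => norm_pos_iff.mpr hx.2

/-- Proposition B: the Hardy–Hénon system has no radial positive solution on `ℝ^N`
if and only if `(N+a)/(p+1) + (N+b)/(q+1) > N-2`. -/
theorem no_radial_positive_solution_iff
    (N : ℕ) (hN : 3 ≤ N) (a b p q : ℝ) (ha : -2 < a) (hb : -2 < b)
    (hp : 0 < p) (hq : 0 < q) :
    (¬ ∃ u v : EuclideanSpace ℝ (Fin N) → ℝ,
        IsHHSol a b p q (univ : Set (EuclideanSpace ℝ (Fin N))) u v ∧
        (∃ U : ℝ → ℝ, ∀ x, u x = U ‖x‖) ∧ (∃ V : ℝ → ℝ, ∀ x, v x = V ‖x‖)) ↔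
      ((N : ℝ) + a) / (p + 1) + ((N : ℝ) + b) / (q + 1) > (N : ℝ) - 2 := by
  have hn : (2 : ℝ) < N := by exact_mod_cast hN
  refine ⟨fun hne => ?_, ?_⟩
  · by_contra! hsup
    obtain ⟨U, V, P, Q, hUc, hVc, hUpos, hVpos, hU, hV, hP, hQ⟩ :=
      exists_positive_entire_solution hn ha hb hp hq hsup
    have hUC := contDiffOn_two_of_flux hU hP
      (hVc.continuousOn.rpow_const fun r hr => Or.inr hp.le)
    have hVC := contDiffOn_two_of_flux hV hQ
      (hUc.continuousOn.rpow_const fun r hr => Or.inr hq.le)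
    refine hne ⟨fun x => U ‖x‖, fun x => V ‖x‖, ⟨(hUc.comp continuous_norm).continuousOn,
      (hVc.comp continuous_norm).continuousOn, contDiffOn_comp_norm hUC, contDiffOn_comp_norm hVC,
      fun x _ => hUpos _ (norm_nonneg x), fun x _ => hVpos _ (norm_nonneg x), fun x hx => ?_,
      fun x hx => ?_⟩, ⟨U, fun _ => rfl⟩, V, fun _ => rfl⟩
    · rw [lap_eq_of_flux (F := fun r => V r ^ p) hU hP hx.2, neg_neg]
    · rw [lap_eq_of_flux (F := fun r => U r ^ q) hV hQ hx.2, neg_neg]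
  · rintro hsub ⟨u, v, ⟨huc, hvc, hud, hvd, hupos, hvpos, hul, hvl⟩, ⟨U, hu⟩, V, hv⟩
    obtain ⟨hUc, P, hU, hP⟩ := exists_flux_of_radial (F := fun r => V r ^ p) (by omega) hu
      (continuousOn_univ.mp huc) hud fun x hx => by rw [hul x ⟨mem_univ x, hx⟩, hv]
    obtain ⟨hVc, Q, hV, hQ⟩ := exists_flux_of_radial (F := fun r => U r ^ q) (by omega) hv
      (continuousOn_univ.mp hvc) hvd fun x hx => by rw [hvl x ⟨mem_univ x, hx⟩, hu]
    have hnorm : ∀ r > 0, ∃ x : EuclideanSpace ℝ (Fin N), ‖x‖ = r := fun r hr =>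
      ⟨EuclideanSpace.single ⟨0, by omega⟩ r, by simp [abs_of_pos hr]⟩
    refine no_positive_entire_solution hn ha hb hp hq hsub hUc hVc (fun r hr => ?_) (fun r hr => ?_)
      hU hV hP hQ
    · obtain ⟨x, rfl⟩ := hnorm r hr
      exact (hupos x (mem_univ x)).trans_eq (hu x)
    · obtain ⟨x, rfl⟩ := hnorm r hr
      exact (hvpos x (mem_univ x)).trans_eq (hv x)
end
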